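/- Let E be a non-vanishing extended multi-segment datum whose order satisfies (P′) and which is minimal, and let B > 1/2 be a rational number. Write E = E_{<B} + E_{≥B}, where E_{≥B} consists of the rows with B_i ≥ B (these come last, since the order satisfies (P′)). Then E_{<B} + sh^{−1}(E_{≥B}), obtained by shifting every row with B_i ≥ B one step to the left, is again a non-vanishing extended multi-segment datum. (The first assertion of Lemma 5.8 of the paper.) -/

import Mathlib

/-!
Common combinatorial setting for extended multi-segments (Moeglin-Atobe theory),
following Hazeltine-Liu-Lo, "On the intersection of local Arthur packets".
Rows of symbols are 0-indexed; row labels of labeled symbols are natural numbers.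
-/

namespace LocalArthur

/-- A row `([A,B], l, eta)` of a symbol (an extended segment with the bound on `l` dropped). -/
structure Row where
  A : ℚ
  B : ℚ
  l : ℚ
  eta : ℤ
deriving DecidableEq

/-- `a = A + B + 1`. -/
def Row.a (r : Row) : ℚ := r.A + r.B + 1

/-- `b = A - B + 1`. -/
def Row.b (r : Row) : ℚ := r.A - r.B + 1

/-- A rational number is an integer. -/
def IsInt (x : ℚ) : Prop := x.den = 1

instance (x : ℚ) : Decidable (IsInt x) := by unfold IsInt; infer_instance

/-- `(-1)^x` for an integer-valued rational `x` (junk value on non-integers). -/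
def m1pow (x : ℚ) : ℤ := if x.num % 2 = 0 then 1 else -1

/-- Validity of a single row: `2A, 2B ∈ ℤ`, `A - B ∈ ℕ`, `l ∈ ℤ`, `eta = ±1`. -/
def Row.IsES (r : Row) : Prop :=
  IsInt (2 * r.A) ∧ IsInt (2 * r.B) ∧ (∃ n : ℕ, r.A - r.B = (n : ℚ)) ∧
    IsInt r.l ∧ (r.eta = 1 ∨ r.eta = -1)

/-- The segment `[A,B]` of `r` is contained in that of `s`. -/
def Row.subseg (r s : Row) : Prop := s.B ≤ r.B ∧ r.A ≤ s.A

instance (r s : Row) : Decidable (r.subseg s) := by unfold Row.subseg; infer_instance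

/-- A symbol: valid rows, `A_i + B_i ≥ 0`, all `A_i` congruent mod `ℤ`, and the
listed order admissible, i.e. condition (P). -/
def IsSymbol (E : List Row) : Prop :=
  (∀ r ∈ E, r.IsES) ∧ (∀ r ∈ E, 0 ≤ r.A + r.B) ∧
    (∀ r ∈ E, ∀ s ∈ E, IsInt (r.A - s.A)) ∧
    E.Pairwise (fun r s => ¬ (s.A < r.A ∧ s.B < r.B))

/-- An extended multi-segment datum: a symbol with `0 ≤ l_i ≤ b_i / 2`. -/
def IsEMS (E : List Row) : Prop :=
  IsSymbol E ∧ ∀ r ∈ E, 0 ≤ r.l ∧ r.l ≤ r.b / 2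

/-- The listed order satisfies (P'). -/
def Pprime (E : List Row) : Prop := E.Pairwise (fun r s => r.B ≤ s.B)

/-- Equivalence of extended segments. -/
def Row.Equiv (r s : Row) : Prop :=
  r.A = s.A ∧ r.B = s.B ∧ r.l = s.l ∧ (r.eta = s.eta ∨ r.l = r.b / 2)

/-- Rowwise equivalence of symbols. -/
def SymEquiv (E F : List Row) : Prop := List.Forall₂ Row.Equiv E F

/-- Shift of one row: `[A,B] ↦ [A+d, B+d]`. -/
def Row.sh (r : Row) (d : ℤ) : Row := { r with A := r.A + d, B := r.B + d }

/-- Add on one row: `([A,B],l) ↦ ([A+d, B-d], l+d)`. -/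
def Row.addOp (r : Row) (d : ℤ) : Row :=
  { r with A := r.A + d, B := r.B - d, l := r.l + d }

/-- `sh^d` applied to every row. -/
def shAll (d : ℤ) (E : List Row) : List Row := E.map fun r => r.sh d

/-- The updated pair of rows in a row exchange of rows `r = row k` and `s = row k+1`
(assuming one of the segments contains the other); the first component is the new row
at position `k` (the updated `s`) and the second the new row at position `k+1`
(the updated `r`). -/
def rexPair (r s : Row) : Row × Row :=
  if r.subseg s then
    -- Case `[A_k,B_k] ⊆ [A_{k+1},B_{k+1}]`
    (if m1pow (r.A - r.B) * r.eta * s.eta = 1 then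
        if s.b - 2 * s.l < 2 * (r.b - 2 * r.l) then
          (⟨s.A, s.B, s.b - (s.l + (r.b - 2 * r.l)), m1pow (r.A - r.B) * s.eta⟩ : Row)
        else ⟨s.A, s.B, s.l + (r.b - 2 * r.l), m1pow (r.A - r.B + 1) * s.eta⟩
      else ⟨s.A, s.B, s.l - (r.b - 2 * r.l), m1pow (r.A - r.B + 1) * s.eta⟩,
     ⟨r.A, r.B, r.l, m1pow (s.A - s.B) * r.eta⟩)
  else
    -- Case `[A_{k+1},B_{k+1}] ⊊ [A_k,B_k]`
    (⟨s.A, s.B, s.l, m1pow (r.A - r.B) * s.eta⟩,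
     if m1pow (r.A - r.B) * r.eta * s.eta = 1 then
        if r.b - 2 * r.l < 2 * (s.b - 2 * s.l) then
          (⟨r.A, r.B, r.b - (r.l + (s.b - 2 * s.l)), m1pow (s.A - s.B) * r.eta⟩ : Row)
        else ⟨r.A, r.B, r.l + (s.b - 2 * s.l), m1pow (s.A - s.B + 1) * r.eta⟩
      else ⟨r.A, r.B, r.l - (s.b - 2 * s.l), m1pow (s.A - s.B + 1) * r.eta⟩)

/-- Row exchange `R_k` at positions `k, k+1` (0-indexed). -/
def rex (k : ℕ) (E : List Row) : List Row :=
  match E[k]?, E[k+1]? with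
  | some r, some s =>
      if r.subseg s ∨ s.subseg r then
        E.take k ++ (rexPair r s).1 :: (rexPair r s).2 :: E.drop (k + 2)
      else E
  | _, _ => E

/-- One row exchange step. -/
def ReorderStep (E F : List Row) : Prop := ∃ k, F = rex k E

/-- Admissible reorderings: finite sequences of row exchanges. -/
def Reorder : List Row → List Row → Prop := Relation.ReflTransGen ReorderStep

/-- Coincidence up to row exchanges (in either direction) and rowwise equivalence. -/
def UpToRex (E F : List Row) : Prop :=
  ∃ G, Relation.ReflTransGen (fun X Y => ReorderStep X Y ∨ ReorderStep Y X) E G ∧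
    SymEquiv G F

/-- `α_i = ∑_{j<i} (A_j + B_j + 1)`. -/
def alphaAt (E : List Row) (i : ℕ) : ℚ := ((E.take i).map Row.a).sum

/-- `β_i = ∑_{j>i} (A_j - B_j + 1)`. -/
def betaAt (E : List Row) (i : ℕ) : ℚ := ((E.drop (i + 1)).map Row.b).sum

/-- `γ_i = ∑_{j>i} (A_j + B_j + 1)`. -/
def gammaAt (E : List Row) (i : ℕ) : ℚ := ((E.drop (i + 1)).map Row.a).sum

/-- Condition (∗) of the non-vanishing criterion. -/
def StarCond (E : List Row) : Prop :=
  ∀ i : ℕ, ∀ r : Row, E[i]? = some r →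
    (IsInt r.B → 0 ≤ r.B + r.l) ∧
    (¬ IsInt r.B → r.eta = - m1pow (alphaAt E i) → (1 / 2 : ℚ) ≤ r.B + r.l) ∧
    (¬ IsInt r.B → r.eta = m1pow (alphaAt E i) → -(1 / 2 : ℚ) ≤ r.B + r.l)

/-- Xu's non-vanishing conditions at an adjacent pair of rows `(r, s) = (row k, row k+1)`. -/
def XuPair (r s : Row) : Prop :=
  ((r.A ≤ s.A ∧ r.B ≤ s.B) →
    (m1pow (r.A - r.B) * r.eta * s.eta = 1 →
        r.B + r.l ≤ s.B + s.l ∧ r.A - r.l ≤ s.A - s.l) ∧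
    (m1pow (r.A - r.B) * r.eta * s.eta = -1 → r.A - r.l < s.B + s.l)) ∧
  ((r.subseg s ∧ ¬ s.subseg r) →
    (m1pow (r.A - r.B) * r.eta * s.eta = 1 → 0 ≤ s.l - r.l ∧ s.l - r.l ≤ s.b - r.b) ∧
    (m1pow (r.A - r.B) * r.eta * s.eta = -1 → r.b ≤ r.l + s.l)) ∧
  ((s.subseg r ∧ ¬ r.subseg s) →
    (m1pow (r.A - r.B) * r.eta * s.eta = 1 → 0 ≤ r.l - s.l ∧ r.l - s.l ≤ r.b - s.b) ∧
    (m1pow (r.A - r.B) * r.eta * s.eta = -1 → s.b ≤ r.l + s.l))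

/-- Xu's non-vanishing conditions at every adjacent pair of rows. -/
def XuAll (E : List Row) : Prop := E.Chain' XuPair

/-- The non-vanishing criterion for an extended multi-segment datum. -/
def NonVanishing (E : List Row) : Prop :=
  StarCond E ∧
    ∀ d : ℕ, (∀ r ∈ E, 0 ≤ r.B + (d : ℚ)) →
      ∀ F, Reorder (shAll d E) F → XuAll F

/-- Applicability of a union-intersection at an adjacent pair of rows. -/
def uiApplicablePair (r s : Row) : Prop :=
  r.A < s.A ∧ r.B < s.B ∧
    ((m1pow (r.A - r.B) * r.eta * s.eta = 1 ∧
        (s.A - s.l = r.A - r.l ∨ s.B + s.l = r.B + r.l)) ∨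
      (m1pow (r.A - r.B) * r.eta * s.eta = -1 ∧ s.B + s.l = r.A - r.l + 1))

instance (r s : Row) : Decidable (uiApplicablePair r s) := by
  unfold uiApplicablePair; infer_instance

/-- Type 3' of a union-intersection at an adjacent pair. -/
def uiT3 (r s : Row) : Prop :=
  r.l = 0 ∧ s.l = 0 ∧ m1pow (r.A - r.B) * r.eta * s.eta = -1

instance (r s : Row) : Decidable (uiT3 r s) := by unfold uiT3; infer_instance

/-- The pair of rows produced by a union-intersection at an adjacent applicable pair. -/
def uiPair (r s : Row) : Row × Row :=
  if m1pow (r.A - r.B) * r.eta * s.eta = 1 then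
    if s.A - s.l = r.A - r.l then
      -- Case 1
      ((⟨s.A, r.B, r.l, r.eta⟩ : Row),
       (⟨r.A, s.B, s.l - (s.A - r.A), m1pow (s.A - r.A) * s.eta⟩ : Row))
    else
      -- Case 2
      if s.A - r.A ≤ r.b - 2 * r.l then
        (⟨s.A, r.B, r.l + (s.A - r.A), r.eta⟩,
         ⟨r.A, s.B, s.l, m1pow (s.A - r.A) * s.eta⟩)
      else
        (⟨s.A, r.B, r.b - r.l, - r.eta⟩,
         ⟨r.A, s.B, s.l, m1pow (s.A - r.A) * s.eta⟩)
  else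
    -- Case 3
    if s.l ≤ r.l then
      (⟨s.A, r.B, r.l, r.eta⟩, ⟨r.A, s.B, s.l, m1pow (s.A - r.A) * s.eta⟩)
    else
      (⟨s.A, r.B, r.l, r.eta⟩, ⟨r.A, s.B, r.l, m1pow (s.A - r.A + 1) * s.eta⟩)

/-- Union-intersection at positions `k, k+1` (deleting the second new row in type 3'). -/
def uiAt (k : ℕ) (E : List Row) : List Row :=
  match E[k]?, E[k+1]? with
  | some r, some s =>
      if uiApplicablePair r s then
        if uiT3 r s then
          E.take k ++ (uiPair r s).1 :: E.drop (k + 2)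
        else
          E.take k ++ (uiPair r s).1 :: (uiPair r s).2 :: E.drop (k + 2)
      else E
  | _, _ => E

/-- Minimality: no union-intersection is applicable. -/
def MinimalP (E : List Row) : Prop :=
  ∀ F, Reorder E F → ∀ k r s, F[k]? = some r → F[k+1]? = some s →
    ¬ uiApplicablePair r s

/-- The image of a row under Atobe's dual. -/
def dualRow (E : List Row) (i : ℕ) (r : Row) : Row :=
  let α := alphaAt E i
  let β := betaAt E i
  let η₀ : ℤ := if ¬ IsInt r.B ∧ r.l = r.b / 2 then - m1pow α else r.eta
  if IsInt r.B then
    ⟨r.A, -r.B, r.l + r.B, m1pow (α + β) * η₀⟩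
  else
    ⟨r.A, -r.B, r.l + r.B + ((m1pow α * η₀ : ℤ) : ℚ) / 2, - (m1pow (α + β) * η₀)⟩

/-- Atobe's dual of a symbol whose order satisfies (P'). -/
def dual (E : List Row) : List Row :=
  (E.mapIdx fun i r => dualRow E i r).reverse

/-- Applicability of the partial dual `dual_k^+` at position `k` (0-indexed). -/
def DualPlusApplicable (E : List Row) (k : ℕ) : Prop :=
  ∃ r, E[k]? = some r ∧ r.B = 1 / 2 ∧ r.l = 0 ∧ r.eta = - m1pow (alphaAt E k) ∧
    ∀ i, i < k → ∀ s, E[i]? = some s → s.B < 1 / 2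

/-- The partial dual `dual_k^+` at position `k`. -/
def dualPlus (k : ℕ) (E : List Row) : List Row :=
  match E[k]? with
  | some rk =>
      (dual ((dual E).set (E.length - 1 - k)
          ⟨rk.A, 1 / 2, 0, - m1pow (gammaAt E k)⟩)).take k ++
        (⟨rk.A, -(1 / 2), 0, - rk.eta⟩ : Row) :: E.drop (k + 1)
  | none => E

/-- Applicability of the partial dual `dual_k^-`. -/
def DualMinusApplicable (E : List Row) (k : ℕ) : Prop :=
  DualPlusApplicable (dual E) (E.length - 1 - k)

/-- The partial dual `dual_k^-`. -/
def dualMinus (k : ℕ) (E : List Row) : List Row :=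
  dual (dualPlus (E.length - 1 - k) (dual E))

/-- Maximality: `E` is not, up to row exchanges, the result of a union-intersection
applied to a non-vanishing extended multi-segment datum. -/
def Maximal (E : List Row) : Prop :=
  ¬ ∃ (E'' F : List Row) (k : ℕ) (r s : Row), IsEMS E'' ∧ NonVanishing E'' ∧
      Reorder E'' F ∧ F[k]? = some r ∧ F[k+1]? = some s ∧ uiApplicablePair r s ∧
      UpToRex (uiAt k F) E

/-- Absolute maximality. -/
def AbsolutelyMaximal (E : List Row) : Prop := Maximal E ∧ MinimalP (dual E)

/-- The sign `(-1)^{⌊b/2⌋ + l} * eta^b` of a row. -/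
def rowSign (r : Row) : ℤ :=
  (if (⌊r.b / 2⌋ + ⌊r.l⌋) % 2 = 0 then (1 : ℤ) else -1) * r.eta ^ (⌊r.b⌋.toNat)

/-- The sign product of a symbol. -/
def signProd (E : List Row) : ℤ := (E.map rowSign).prod

/-! ### Labeled symbols: rows carry labels that travel with them under reorderings. -/

/-- A labeled row. -/
abbrev LRow := ℕ × Row

/-- The underlying list of rows of a labeled symbol. -/
def rows (L : List LRow) : List Row := L.map Prod.snd

/-- `sh_i^d`, acting on the row labeled `i`. -/
def shL (i : ℕ) (d : ℤ) (L : List LRow) : List LRow :=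
  L.map fun p => if p.1 = i then (p.1, p.2.sh d) else p

/-- `add_i^d`, acting on the row labeled `i`. -/
def addL (i : ℕ) (d : ℤ) (L : List LRow) : List LRow :=
  L.map fun p => if p.1 = i then (p.1, p.2.addOp d) else p

/-- `sh^d` on a labeled symbol. -/
def shAllL (d : ℤ) (L : List LRow) : List LRow := L.map fun p => (p.1, p.2.sh d)

/-- Row exchange at positions `k, k+1` on a labeled symbol. -/
def rexL (k : ℕ) (L : List LRow) : List LRow :=
  match L[k]?, L[k+1]? with
  | some (a, r), some (c, s) =>
      if r.subseg s ∨ s.subseg r then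
        L.take k ++ (c, (rexPair r s).1) :: (a, (rexPair r s).2) :: L.drop (k + 2)
      else L
  | _, _ => L

/-- One row exchange step on labeled symbols. -/
def ReorderStepL (L M : List LRow) : Prop := ∃ k, M = rexL k L

/-- Admissible reorderings of labeled symbols. -/
def ReorderL : List LRow → List LRow → Prop := Relation.ReflTransGen ReorderStepL

/-- Labelwise equivalence of labeled symbols. -/
def LSymEquiv (L M : List LRow) : Prop :=
  List.Forall₂ (fun p q => p.1 = q.1 ∧ Row.Equiv p.2 q.2) L M

/-- `M` coincides with `L` up to row exchanges and rowwise equivalence (labels forgotten). -/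
def CoincidesUpToRex (L M : List LRow) : Prop :=
  ∃ L', Relation.ReflTransGen (fun X Y => ReorderStepL X Y ∨ ReorderStepL Y X) L L' ∧
    SymEquiv (rows L') (rows M)

/-- Union-intersection at positions `k, k+1` on a labeled symbol. -/
def uiAtL (k : ℕ) (L : List LRow) : List LRow :=
  match L[k]?, L[k+1]? with
  | some (a, r), some (c, s) =>
      if uiApplicablePair r s then
        if uiT3 r s then
          L.take k ++ (a, (uiPair r s).1) :: L.drop (k + 2)
        else
          L.take k ++ (a, (uiPair r s).1) :: (c, (uiPair r s).2) :: L.drop (k + 2)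
      else L
  | _, _ => L

/-- The relation `M = ui_{i,j}(L)`, with a constraint `P` on the adjacent pair used:
some admissible reordering `L'` of `L` puts the row labeled `i` immediately before the
row labeled `j`, `ui` is applicable there, and `M` is obtained from the result by row
exchanges restoring the original relative order of the (surviving) labels. -/
def UIrelWith (P : Row → Row → Prop) (L : List LRow) (i j : ℕ) (M : List LRow) : Prop :=
  ∃ (L' : List LRow) (k : ℕ) (r s : Row),
    ReorderL L L' ∧ L'[k]? = some (i, r) ∧ L'[k+1]? = some (j, s) ∧
    uiApplicablePair r s ∧ P r s ∧
    ReorderL (uiAtL k L') M ∧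
    M.map Prod.fst =
      (L.map Prod.fst).filter fun x => decide (x ∈ (uiAtL k L').map Prod.fst)

/-- The relation `M = ui_{i,j}(L)`. -/
def UIrel (L : List LRow) (i j : ℕ) (M : List LRow) : Prop :=
  UIrelWith (fun _ _ => True) L i j M

/-- Atobe's dual of a labeled symbol. -/
def dualL (L : List LRow) : List LRow :=
  (L.mapIdx fun i p => (p.1, dualRow (rows L) i p.2)).reverse

/-- The partial dual `dual^+` at position `k` on a labeled symbol. -/
def dualPlusL (k : ℕ) (L : List LRow) : List LRow :=
  match L[k]? with
  | some (lab, rk) =>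
      (dualL ((dualL L).set (L.length - 1 - k)
          (lab, ⟨rk.A, 1 / 2, 0, - m1pow (gammaAt (rows L) k)⟩))).take k ++
        (lab, (⟨rk.A, -(1 / 2), 0, - rk.eta⟩ : Row)) :: L.drop (k + 1)
  | none => L

/-- Position of the row labeled `i`. -/
def posOf (L : List LRow) (i : ℕ) : ℕ := L.findIdx fun p => p.1 == i

/-- The partial dual `dual_i^+`, acting at the row labeled `i`. -/
def dualPlusLab (i : ℕ) (L : List LRow) : List LRow := dualPlusL (posOf L i) L

/-- Applicability of `dual_i^+` on a labeled symbol. -/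
def DualPlusApplicableLab (i : ℕ) (L : List LRow) : Prop :=
  i ∈ L.map Prod.fst ∧ DualPlusApplicable (rows L) (posOf L i)

/-- The partial dual `dual_i^-` on a labeled symbol. -/
def dualMinusLab (i : ℕ) (L : List LRow) : List LRow := dualL (dualPlusLab i (dualL L))

/-- Applicability of `dual_i^-` on a labeled symbol. -/
def DualMinusApplicableLab (i : ℕ) (L : List LRow) : Prop :=
  DualPlusApplicableLab i (dualL L)

/-- One basic operator step: a row exchange, a union-intersection, a composition
`dual ∘ ui_{i,j} ∘ dual`, or an inverse of one of these. -/
def BasicStep (L M : List LRow) : Prop :=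
  (∃ k, M = rexL k L) ∨ (∃ k, L = rexL k M) ∨
  (∃ i j, UIrel L i j M) ∨ (∃ i j, UIrel M i j L) ∨
  (∃ i j N, UIrel (dualL L) i j N ∧ M = dualL N) ∨
  (∃ i j N, UIrel (dualL M) i j N ∧ L = dualL N)

/-- Finite sequences of basic operators. -/
def Basic : List LRow → List LRow → Prop := Relation.ReflTransGen BasicStep

/-- Shift every row after position `j` one step to the right. -/
def shAfter (j : ℕ) (E : List Row) : List Row :=
  E.mapIdx fun i r => if j < i then r.sh 1 else r

/-- Shift every row with `B_i ≥ B` one step to the left. -/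
def shiftGE (B : ℚ) (E : List Row) : List Row :=
  E.map fun r => if B ≤ r.B then r.sh (-1) else r

/-- Shift every row with `B_i ≥ 1/2` one step to the left, deleting the rows of the
form `([1/2,1/2], 0, η)`. -/
def shiftHalfDel (E : List Row) : List Row :=
  (E.filter fun r => !decide (r.A = 1 / 2 ∧ r.B = 1 / 2 ∧ r.l = 0)).map
    fun r => if (1 / 2 : ℚ) ≤ r.B then r.sh (-1) else r

/-- The rows `([A-r, -(A-r)-1], ⌊A⌋-r, 1)` for `r = 0, …, ⌊A⌋`. -/
def prefixRows (A : ℚ) : List Row :=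
  (List.range (⌊A⌋.toNat + 1)).map fun r =>
    ⟨A - r, -(A - r) - 1, (⌊A⌋ : ℚ) - r, 1⟩

/-! ### The reflection model

Recording a row by its segment and the signed integer `x = ± (b - 2 l)`, the sign being `η`
normalized by the rows in front of it, a row exchange reflects the value of the larger segment
through the value of the smaller one, and Xu's conditions say that `x` is 1-Lipschitz for the
`ℓ¹`-distance of the points `(A, B)`. -/

namespace Model

/-- The strict order of segments with end points `a i` and `b i`; equal segments are ordered by
their labels. -/
def Lt (a b : ℕ → ℤ) (i j : ℕ) : Prop :=
  (a i < a j ∧ b i < b j) ∨ (a i = a j ∧ b i = b j ∧ i < j)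

/-- The segment labeled `i` strictly contains the one labeled `j`. -/
def Nest (a b : ℕ → ℤ) (i j : ℕ) : Prop :=
  a j ≤ a i ∧ b i ≤ b j ∧ (a j < a i ∨ b i < b j)

/-- The `ℓ¹`-distance of two segments. -/
def dist (a b : ℕ → ℤ) (i j : ℕ) : ℕ := (a i - a j).natAbs + (b i - b j).natAbs

/-- The coordinate `f`, lowered by one for the labels with `T ≤ b i`. -/
def lower (T : ℤ) (b f : ℕ → ℤ) (i : ℕ) : ℤ := if T ≤ b i then f i - 1 else f i

/-- Exchange of two adjacent nested rows: the larger one is reflected through the smaller one. -/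
inductive Step (a b : ℕ → ℤ) : List (ℕ × ℤ) → List (ℕ × ℤ) → Prop
  | left (P S : List (ℕ × ℤ)) (i j : ℕ) (x y : ℤ) (h : Nest a b i j) :
      Step a b (P ++ (i, x) :: (j, y) :: S) (P ++ (j, y) :: (i, 2 * y - x) :: S)
  | right (P S : List (ℕ × ℤ)) (i j : ℕ) (x y : ℤ) (h : Nest a b j i) :
      Step a b (P ++ (i, x) :: (j, y) :: S) (P ++ (j, 2 * x - y) :: (i, x) :: S)

/-- Finite sequences of exchanges. -/
abbrev Steps (a b : ℕ → ℤ) : List (ℕ × ℤ) → List (ℕ × ℤ) → Prop := Relation.ReflTransGen (Step a b)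

/-- The list of labels. -/
def labels (L : List (ℕ × ℤ)) : List ℕ := L.map Prod.fst

/-- A list of labels is a linear extension of the strict order. -/
def Sorted (a b : ℕ → ℤ) (σ : List ℕ) : Prop := σ.Pairwise fun i j => ¬ Lt a b j i

variable {a b : ℕ → ℤ}

theorem Lt.trans {i j k : ℕ} (h : Lt a b i j) (h' : Lt a b j k) : Lt a b i k := by
  unfold Lt at *; omega

theorem Lt.asymm {i j : ℕ} (h : Lt a b i j) : ¬ Lt a b j i := by
  unfold Lt at *; omega

theorem Lt.label_lt (hb : Monotone b) {i j : ℕ} (h : Lt a b i j) : i < j := by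
  by_contra hij
  have := hb (not_lt.1 hij)
  unfold Lt at h; omega

theorem nest_or_nest {i j : ℕ} (hij : i ≠ j) (h : ¬ Lt a b i j) (h' : ¬ Lt a b j i) :
    Nest a b i j ∨ Nest a b j i := by
  unfold Lt Nest at *; omega

theorem Nest.trans {i j k : ℕ} (h : Nest a b i j) (h' : Nest a b j k) : Nest a b i k := by
  unfold Nest at *; omega

theorem Nest.not_lt {i j : ℕ} (h : Nest a b i j) : ¬ Lt a b i j ∧ ¬ Lt a b j i := by
  unfold Lt Nest at *; omega

theorem Nest.asymm {i j : ℕ} (h : Nest a b i j) : ¬ Nest a b j i := by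
  unfold Nest at *; omega

theorem Nest.dist_add {i j k : ℕ} (h : Nest a b i j) (h' : Nest a b j k) :
    dist a b i j + dist a b j k = dist a b i k ∧ 0 < dist a b i j ∧ 0 < dist a b j k := by
  unfold Nest dist at *; omega

theorem dist_comm (i j : ℕ) : dist a b i j = dist a b j i := by
  unfold dist; omega

theorem Step.context {L M : List (ℕ × ℤ)} (h : Step a b L M) (P S : List (ℕ × ℤ)) :
    Step a b (P ++ L ++ S) (P ++ M ++ S) := by
  cases h with
  | left P' S' i j x y h => simpa using Step.left (P ++ P') (S' ++ S) i j x y h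
  | right P' S' i j x y h => simpa using Step.right (P ++ P') (S' ++ S) i j x y h

theorem Steps.context {L M : List (ℕ × ℤ)} (h : Steps a b L M) (P S : List (ℕ × ℤ)) :
    Steps a b (P ++ L ++ S) (P ++ M ++ S) := by
  induction h with
  | refl => exact .refl
  | tail _ h ih => exact ih.tail (h.context P S)

theorem Step.perm {L M : List (ℕ × ℤ)} (h : Step a b L M) : (labels L).Perm (labels M) := by
  cases h <;> simpa [labels] using (List.Perm.swap _ _ _).append_left _

theorem Steps.perm {L M : List (ℕ × ℤ)} (h : Steps a b L M) : (labels L).Perm (labels M) := by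
  induction h with
  | refl => exact List.Perm.refl _
  | tail _ h ih => exact ih.trans h.perm

theorem Step.sorted {L M : List (ℕ × ℤ)} (h : Step a b L M) (hL : Sorted a b (labels L)) :
    Sorted a b (labels M) := by
  unfold Sorted labels at *
  cases h with
  | left P S i j x y h | right P S i j x y h =>
    have := h.not_lt
    simp only [List.map_append, List.map_cons, List.pairwise_append, List.pairwise_cons,
      List.mem_cons] at hL ⊢
    grind

theorem Steps.sorted {L M : List (ℕ × ℤ)} (h : Steps a b L M) (hL : Sorted a b (labels L)) :
    Sorted a b (labels M) := by
  induction h with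
  | refl => exact hL
  | tail _ h ih => exact h.sorted ih

/-- A pair of adjacent nested rows can be exchanged, in some way. -/
theorem exists_step_pair (p q : ℕ × ℤ) (h : Nest a b p.1 q.1 ∨ Nest a b q.1 p.1) :
    ∃ p' q' : ℕ × ℤ, p'.1 = p.1 ∧ q'.1 = q.1 ∧ Step a b [p, q] [q', p'] := by
  rcases h with h | h
  · exact ⟨(p.1, 2 * q.2 - p.2), q, rfl, rfl, Step.left [] [] p.1 q.1 p.2 q.2 h⟩
  · exact ⟨p, (q.1, 2 * p.2 - q.2), rfl, rfl, Step.right [] [] p.1 q.1 p.2 q.2 h⟩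

theorem bubble_right (Q : List (ℕ × ℤ)) (w : ℕ × ℤ)
    (h : ∀ q ∈ Q, Nest a b w.1 q.1 ∨ Nest a b q.1 w.1) :
    ∃ (w' : ℕ × ℤ) (Q' : List (ℕ × ℤ)), w'.1 = w.1 ∧ labels Q' = labels Q ∧
      Steps a b (w :: Q) (Q' ++ [w']) := by
  induction Q generalizing w with
  | nil => exact ⟨w, [], rfl, rfl, .refl⟩
  | cons q Q ih =>
    obtain ⟨w', q', hw, hq, hs⟩ := exists_step_pair w q (h q (by simp))
    obtain ⟨w'', Q', hw', hQ, hs'⟩ := ih w' fun r hr => by rw [hw]; exact h r (by simp [hr])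
    refine ⟨w'', q' :: Q', hw'.trans hw, by simp [labels, hq] at hQ ⊢; exact hQ, ?_⟩
    exact .head (by simpa using hs.context [] Q) (by simpa using Steps.context hs' [q'] [])

theorem bubble_left (Q : List (ℕ × ℤ)) (w : ℕ × ℤ)
    (h : ∀ q ∈ Q, Nest a b w.1 q.1 ∨ Nest a b q.1 w.1) :
    ∃ (w' : ℕ × ℤ) (Q' : List (ℕ × ℤ)), w'.1 = w.1 ∧ labels Q' = labels Q ∧
      Steps a b (Q ++ [w]) (w' :: Q') := by
  induction Q with
  | nil => exact ⟨w, [], rfl, rfl, .refl⟩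
  | cons q Q ih =>
    obtain ⟨w', Q', hw, hQ, hs⟩ := ih fun r hr => h r (by simp [hr])
    obtain ⟨q', w'', hq, hw', hs'⟩ := exists_step_pair (a := a) (b := b) q w'
      (by rw [hw]; exact (h q (by simp)).symm)
    refine ⟨w'', q' :: Q', hw'.trans hw, by simp [labels, hq] at hQ ⊢; exact hQ, ?_⟩
    exact .tail (by simpa using Steps.context hs [q] []) (by simpa using hs'.context [] Q')

/-- Any two linear extensions are connected by exchanges. -/
theorem exists_steps_of_sorted (σ : List ℕ) (L : List (ℕ × ℤ)) (hp : σ.Perm (labels L))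
    (hn : σ.Nodup) (hσ : Sorted a b σ) (hL : Sorted a b (labels L)) :
    ∃ M, Steps a b L M ∧ labels M = σ := by
  induction σ generalizing L with
  | nil => exact ⟨L, .refl, (List.nil_perm.1 hp)⟩
  | cons s σ ih =>
    obtain ⟨p, hpL, rfl⟩ := List.mem_map.1 (hp.subset (List.mem_cons_self))
    obtain ⟨P, S, rfl⟩ := List.append_of_mem hpL
    have hp' : σ.Perm (labels (P ++ S)) := by
      refine List.Perm.cons_inv (hp.trans ?_)
      simp [labels]
    have hLt := hL
    simp only [Sorted, labels, List.map_append, List.map_cons, List.pairwise_append,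
      List.pairwise_cons, List.mem_cons] at hL
    simp only [Sorted, List.pairwise_cons] at hσ
    obtain ⟨w, Q, hw, hQ, hs⟩ := bubble_left (a := a) (b := b) P p fun q hq => by
      have hqσ : q.1 ∈ σ := hp'.mem_iff.2 (by
        simp only [labels, List.map_append, List.mem_append, List.mem_map]
        exact Or.inl ⟨q, hq, rfl⟩)
      refine nest_or_nest ?_ ?_ ?_
      · rintro h
        exact (List.nodup_cons.1 hn).1 (h ▸ hqσ)
      · exact hL.2.2 q.1 (List.mem_map_of_mem hq) p.1 (Or.inl rfl)
      · exact hσ.1 _ hqσ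
    have hlab : labels (Q ++ S) = labels (P ++ S) := by
      simp only [labels, List.map_append] at hQ ⊢; rw [hQ]
    have hs2 : Steps a b (P ++ p :: S) (w :: (Q ++ S)) := by simpa using hs.context [] S
    obtain ⟨M, hM, hMl⟩ := ih (Q ++ S) (hlab ▸ hp') (List.nodup_cons.1 hn).2 hσ.2
      (List.pairwise_cons.1 (hs2.sorted hLt)).2
    refine ⟨w :: M, hs2.trans (by simpa using hM.context [w] []), ?_⟩
    simp only [labels, List.map_cons] at hMl ⊢
    rw [hw, hMl]

open Classical in
/-- The values of `L`, reflected back through the smaller rows in front of them, are given by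
`c`; the accumulator `f` performs the reflections through the rows already read. -/
def Coherent (a b : ℕ → ℤ) (c : ℕ → ℤ) : (ℕ → ℤ → ℤ) → List (ℕ × ℤ) → Prop
  | _, [] => True
  | f, p :: L => f p.1 p.2 = c p.1 ∧
      Coherent a b c (fun i x => f i (if Nest a b i p.1 then 2 * p.2 - x else x)) L

theorem exists_coherent (L : List (ℕ × ℤ)) (f : ℕ → ℤ → ℤ) (h : (labels L).Nodup) :
    ∃ c, Coherent a b c f L := by
  have congr : ∀ (L : List (ℕ × ℤ)) (f : ℕ → ℤ → ℤ) (c c' : ℕ → ℤ),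
      (∀ i ∈ labels L, c i = c' i) → Coherent a b c f L → Coherent a b c' f L := by
    intro L
    induction L with
    | nil => intros; trivial
    | cons p L ih =>
      intro f c c' hc h
      exact ⟨h.1.trans (hc _ (by simp [labels])),
        ih _ c c' (fun i hi => hc i (List.mem_cons_of_mem _ hi)) h.2⟩
  induction L generalizing f with
  | nil => exact ⟨0, trivial⟩
  | cons p L ih =>
    rw [labels, List.map_cons, List.nodup_cons] at h
    obtain ⟨c, hc⟩ := ih _ h.2
    refine ⟨Function.update c p.1 (f p.1 p.2), by simp, congr _ _ c _ (fun i hi => ?_) hc⟩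
    rw [Function.update_of_ne]
    rintro rfl
    exact h.1 hi

theorem Step.coherent {L M : List (ℕ × ℤ)} (h : Step a b L M) {c : ℕ → ℤ} {f : ℕ → ℤ → ℤ}
    (hL : Coherent a b c f L) : Coherent a b c f M := by
  cases h with
  | left P S i j x y h | right P S i j x y h =>
    induction P generalizing f with
    | cons p P ih => exact ⟨hL.1, ih hL.2⟩
    | nil =>
      obtain ⟨h1, h2, h3⟩ := hL
      have ha := h.asymm
      simp only [List.nil_append, Coherent, h, ha, if_true, if_false] at h1 h2 h3 ⊢
      refine ⟨by simpa using h2, by simpa using h1, ?_⟩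
      convert h3 using 3 with k z
      have hi : Nest a b k i → Nest a b i j → Nest a b k j := Nest.trans
      have hj : Nest a b k j → Nest a b j i → Nest a b k i := Nest.trans
      congr 1
      split_ifs <;> first | ring1 | tauto

theorem Steps.coherent {L M : List (ℕ × ℤ)} (h : Steps a b L M) {c : ℕ → ℤ} {f : ℕ → ℤ → ℤ}
    (hL : Coherent a b c f L) : Coherent a b c f M := by
  induction h with
  | refl => exact hL
  | tail _ h ih => exact h.coherent ih

theorem Coherent.eq {L M : List (ℕ × ℤ)} {c : ℕ → ℤ} {f : ℕ → ℤ → ℤ}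
    (hf : ∀ i, Function.Injective (f i)) (hL : Coherent a b c f L) (hM : Coherent a b c f M)
    (h : labels L = labels M) : L = M := by
  induction L generalizing f M with
  | nil => exact (List.map_eq_nil_iff.1 h.symm).symm
  | cons p L ih =>
    obtain _ | ⟨q, M⟩ := M
    · simp [labels] at h
    obtain ⟨i, x⟩ := p
    obtain ⟨j, y⟩ := q
    simp only [labels, List.map_cons, List.cons.injEq] at h
    obtain ⟨rfl, h⟩ := h
    have hxy : x = y := hf i (hL.1.trans hM.1.symm)
    subst hxy
    rw [ih ?_ hL.2 hM.2 h]
    intro k z z' hz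
    have := hf k hz
    split_ifs at this
    · linarith
    · exact this

/-- The values of a reordering are determined by the order of its labels. -/
theorem Steps.eq_of_labels_eq {L M N : List (ℕ × ℤ)} (hn : (labels L).Nodup)
    (hM : Steps a b L M) (hN : Steps a b L N) (h : labels M = labels N) : M = N := by
  obtain ⟨c, hc⟩ := exists_coherent (a := a) (b := b) L (fun _ x => x) hn
  exact Coherent.eq (fun _ _ _ h => h) (hM.coherent hc) (hN.coherent hc) h

theorem sorted_of_pairwise_le (hb : Monotone b) {σ : List ℕ} (h : σ.Pairwise (· ≤ ·)) :
    Sorted a b σ :=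
  h.imp fun hij hlt => absurd (hlt.label_lt hb) (not_lt.2 hij)

theorem exists_last {α : Type*} (p : α → Prop) (L : List α) (h : ∃ w ∈ L, p w) :
    ∃ P w S, L = P ++ w :: S ∧ p w ∧ ∀ z ∈ S, ¬ p z := by
  induction L with
  | nil => simp at h
  | cons q L ih =>
    by_cases hL : ∃ w ∈ L, p w
    · obtain ⟨P, w, S, rfl, hw⟩ := ih hL
      exact ⟨q :: P, w, S, rfl, hw⟩
    · push Not at hL
      obtain ⟨w, hw, hp⟩ := h
      rcases List.mem_cons.1 hw with rfl | hw
      · exact ⟨[], w, L, rfl, hp, hL⟩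
      · exact absurd hp (hL w hw)

theorem exists_first {α : Type*} (p : α → Prop) (L : List α) (h : ∃ w ∈ L, p w) :
    ∃ P w S, L = P ++ w :: S ∧ p w ∧ ∀ z ∈ P, ¬ p z := by
  obtain ⟨P, w, S, hL, hw, hS⟩ := exists_last p L.reverse (by simpa using h)
  refine ⟨S.reverse, w, P.reverse, ?_, hw, by simpa using hS⟩
  rw [← L.reverse_reverse, hL]
  simp

section Lower

variable {T : ℤ}

theorem Lt.of_lower (hb : Monotone b) {i j : ℕ} (h : Lt (lower T b a) (lower T b b) i j) :
    Lt a b i j := by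
  have hij : i < j → b i ≤ b j := fun h => hb h.le
  unfold Lt lower at *
  split_ifs at h <;> omega

theorem Nest.lower {i j : ℕ} (h : Nest a b i j) : Nest (lower T b a) (lower T b b) i j := by
  unfold Nest Model.lower at *
  split_ifs <;> omega

theorem Lt.dist_lower_add {i j k : ℕ} (h : Lt a b i j) (h' : Lt a b j k) :
    dist (lower T b a) (lower T b b) i j + dist (lower T b a) (lower T b b) j k =
      dist (lower T b a) (lower T b b) i k := by
  unfold Lt dist lower at *
  split_ifs <;> omega

/-- Lowering decreases the distance by at most two, and only for pairs in strict order. -/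
theorem natAbs_le_dist_lower {i j : ℕ} (hji : ¬ Lt a b j i) {x y : ℤ}
    (h : (x - y).natAbs ≤ dist a b i j)
    (hne : a i < a j → b i < b j → (x - y).natAbs ≠ dist a b i j)
    (hx : Even (x - (a i - b i + 1))) (hy : Even (y - (a j - b j + 1))) :
    (x - y).natAbs ≤ dist (lower T b a) (lower T b b) i j := by
  obtain ⟨m, hm⟩ := hx
  obtain ⟨n, hn⟩ := hy
  unfold Lt dist lower at *
  split_ifs <;> omega

theorem Step.lower {L M : List (ℕ × ℤ)} (h : Step a b L M) :
    Step (lower T b a) (lower T b b) L M := by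
  cases h with
  | left P S i j x y h => exact .left P S i j x y h.lower
  | right P S i j x y h => exact .right P S i j x y h.lower

theorem Steps.lower {L M : List (ℕ × ℤ)} (h : Steps a b L M) :
    Steps (lower T b a) (lower T b b) L M := by
  induction h with
  | refl => exact .refl
  | tail _ h ih => exact ih.tail h.lower

end Lower

/-- In all reorderings of `L` in which the rows `i`, `j` are adjacent, in this order, their values
differ by at most the distance of their segments. -/
def Lip (a b : ℕ → ℤ) (L : List (ℕ × ℤ)) (i j : ℕ) : Prop :=
  ∀ P x y S, Steps a b L (P ++ (i, x) :: (j, y) :: S) → (x - y).natAbs ≤ dist a b i j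

section Moves

variable {L Q S : List (ℕ × ℤ)} {i j k : ℕ} {x y z : ℤ}

theorem step_left (h : Nest a b i j) (hL : Steps a b L (Q ++ (i, x) :: (j, y) :: S)) :
    Steps a b L (Q ++ (j, y) :: (i, 2 * y - x) :: S) := hL.tail (.left _ _ _ _ _ _ h)

theorem step_right (h : Nest a b j i) (hL : Steps a b L (Q ++ (i, x) :: (j, y) :: S)) :
    Steps a b L (Q ++ (j, 2 * x - y) :: (i, x) :: S) := hL.tail (.right _ _ _ _ _ _ h)

theorem triangle_left (hL : Steps a b L (Q ++ (k, z) :: (i, x) :: (j, y) :: S))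
    (hk : Nest a b k i ∨ Nest a b i k) (hd : dist a b i k + dist a b k j = dist a b i j)
    (h1 : Lip a b L k i) (h2 : Lip a b L i k) (h3 : Lip a b L k j) :
    (x - y).natAbs ≤ dist a b i j := by
  have e1 := h1 _ _ _ _ hL
  rw [dist_comm] at e1
  rcases hk with hk | hk
  · have hL' := step_left hk hL
    have e2 := h2 _ _ _ _ hL'
    have e3 := h3 (Q ++ [(i, x)]) _ _ _ (by simpa using hL')
    omega
  · have hL' := step_right hk hL
    have e3 := h3 (Q ++ [(i, 2 * z - x)]) _ _ _ (by simpa using hL')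
    omega

theorem triangle_right (hL : Steps a b L (Q ++ (i, x) :: (j, y) :: (k, z) :: S))
    (hk : Nest a b k j ∨ Nest a b j k) (hd : dist a b i k + dist a b k j = dist a b i j)
    (h1 : Lip a b L j k) (h2 : Lip a b L k j) (h3 : Lip a b L i k) :
    (x - y).natAbs ≤ dist a b i j := by
  have hL₁ : Steps a b L ((Q ++ [(i, x)]) ++ (j, y) :: (k, z) :: S) := by simpa using hL
  have e1 := h1 _ _ _ _ hL₁
  rw [dist_comm] at e1
  rcases hk with hk | hk
  · have hL' := step_right hk hL₁
    have e2 := h2 _ _ _ _ hL'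
    have e3 := h3 Q _ _ _ (by simpa using hL')
    omega
  · have hL' := step_left hk hL₁
    have e3 := h3 Q _ _ _ (by simpa using hL')
    omega

/-- A row nested with both rows of an adjacent pair moves past the pair, from left to right,
without changing the difference of the values, unless the pair is controlled by smaller
distances. -/
theorem cross_left (hL : Steps a b L (Q ++ (k, z) :: (i, x) :: (j, y) :: S))
    (hki : Nest a b k i ∨ Nest a b i k) (hkj : Nest a b k j ∨ Nest a b j k)
    (ih : ∀ i' j', dist a b i' j' < dist a b i j → Lip a b L i' j') :
    (x - y).natAbs ≤ dist a b i j ∨ ∃ x' y' z', (x' - y').natAbs = (x - y).natAbs ∧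
      Steps a b L (Q ++ (i, x') :: (j, y') :: (k, z') :: S) := by
  have e1 := dist_comm (a := a) (b := b) i k
  have e2 := dist_comm (a := a) (b := b) k j
  have e3 := dist_comm (a := a) (b := b) i j
  rcases hki with hki | hki <;> rcases hkj with hkj | hkj
  · have h1 := step_left hki hL
    have h2 := step_left (Q := Q ++ [(i, x)]) hkj (by simpa using h1)
    exact Or.inr ⟨_, _, _, rfl, by simpa using h2⟩
  · have := hkj.dist_add hki
    exact Or.inl (triangle_left hL (.inl hki) (by omega) (ih _ _ (by omega)) (ih _ _ (by omega))
      (ih _ _ (by omega)))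
  · have := hki.dist_add hkj
    exact Or.inl (triangle_left hL (.inr hki) (by omega) (ih _ _ (by omega)) (ih _ _ (by omega))
      (ih _ _ (by omega)))
  · have h1 := step_right hki hL
    have h2 := step_right (Q := Q ++ [(i, 2 * z - x)]) hkj (by simpa using h1)
    exact Or.inr ⟨2 * z - x, 2 * z - y, z, by omega, by simpa using h2⟩

/-- The mirror image of `cross_left`. -/
theorem cross_right (hL : Steps a b L (Q ++ (i, x) :: (j, y) :: (k, z) :: S))
    (hki : Nest a b k i ∨ Nest a b i k) (hkj : Nest a b k j ∨ Nest a b j k)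
    (ih : ∀ i' j', dist a b i' j' < dist a b i j → Lip a b L i' j') :
    (x - y).natAbs ≤ dist a b i j ∨ ∃ x' y' z', (x' - y').natAbs = (x - y).natAbs ∧
      Steps a b L (Q ++ (k, z') :: (i, x') :: (j, y') :: S) := by
  have e1 := dist_comm (a := a) (b := b) i k
  have e2 := dist_comm (a := a) (b := b) k j
  have e3 := dist_comm (a := a) (b := b) i j
  have hL₁ : Steps a b L ((Q ++ [(i, x)]) ++ (j, y) :: (k, z) :: S) := by simpa using hL
  rcases hki with hki | hki <;> rcases hkj with hkj | hkj
  · have h1 := step_right hkj hL₁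
    have h2 := step_right (Q := Q) hki (by simpa using h1)
    exact Or.inr ⟨_, _, _, rfl, h2⟩
  · have := hkj.dist_add hki
    exact Or.inl (triangle_right hL (.inr hkj) (by omega) (ih _ _ (by omega)) (ih _ _ (by omega))
      (ih _ _ (by omega)))
  · have := hki.dist_add hkj
    exact Or.inl (triangle_right hL (.inl hkj) (by omega) (ih _ _ (by omega)) (ih _ _ (by omega))
      (ih _ _ (by omega)))
  · have h1 := step_left hkj hL₁
    have h2 := step_left (Q := Q) hki (by simpa using h1)
    exact Or.inr ⟨2 * z - x, 2 * z - y, z, by omega, h2⟩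

end Moves

section Main

variable {T : ℤ} {L : List (ℕ × ℤ)} {i j : ℕ}

/-- The row `k` must stand before an adjacent pair `i`, `j`. -/
def Before (a b : ℕ → ℤ) (i j k : ℕ) : Prop := Lt a b k i ∨ (Lt a b k j ∧ ¬ Lt a b i k)

theorem Before.of_lt {k l : ℕ} (h : Before a b i j l) (hkl : Lt a b k l) : Before a b i j k :=
  h.imp hkl.trans fun h => ⟨hkl.trans h.1, fun h' => h.2 (h'.trans hkl)⟩

/-- The bound for a pair whose surrounding rows are on the sides they occupy in an unlowered
reordering. -/
theorem natAbs_le_of_placed (hb : Monotone b) (hn : (labels L).Nodup)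
    (hs : Sorted a b (labels L))
    (hold : ∀ P u v S, Steps a b L (P ++ u :: v :: S) →
      (u.2 - v.2).natAbs ≤ dist (lower T b a) (lower T b b) u.1 v.1)
    (hij : ¬ Lt a b j i) {P S : List (ℕ × ℤ)} {x y : ℤ}
    (hL : Steps (lower T b a) (lower T b b) L (P ++ (i, x) :: (j, y) :: S))
    (hP : ∀ w ∈ P, Before a b i j w.1) (hS : ∀ w ∈ S, ¬ Lt a b w.1 i ∧ ¬ Lt a b w.1 j) :
    (x - y).natAbs ≤ dist (lower T b a) (lower T b b) i j := by
  have hsort := hL.sorted (hs.imp fun h h' => h (h'.of_lower hb))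
  have hnd := hL.perm.nodup_iff.1 hn
  simp only [Sorted, labels, List.map_append, List.map_cons, List.pairwise_append,
    List.pairwise_cons, List.mem_cons, List.nodup_append, List.nodup_cons] at hsort hnd
  have pP := (labels P).mergeSort_perm (fun i j => decide (i ≤ j))
  have pS := (labels S).mergeSort_perm (fun i j => decide (i ≤ j))
  have sP := (labels P).pairwise_mergeSort (le := fun i j => decide (i ≤ j))
    (by simpa using fun _ _ _ => le_trans) (by simpa using le_total)
  have sS := (labels S).pairwise_mergeSort (le := fun i j => decide (i ≤ j))
    (by simpa using fun _ _ _ => le_trans) (by simpa using le_total)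
  generalize (labels P).mergeSort (fun i j => decide (i ≤ j)) = σ at pP sP
  generalize (labels S).mergeSort (fun i j => decide (i ≤ j)) = τ at pS sS
  have oP : Sorted a b σ := sorted_of_pairwise_le hb (by simpa using sP)
  have oS : Sorted a b τ := sorted_of_pairwise_le hb (by simpa using sS)
  obtain ⟨P', hP', rfl⟩ := exists_steps_of_sorted (a := lower T b a) (b := lower T b b) σ P pP
    (pP.nodup_iff.2 hnd.1) (oP.imp fun h h' => h (h'.of_lower hb)) hsort.1
  obtain ⟨S', hS', rfl⟩ := exists_steps_of_sorted (a := lower T b a) (b := lower T b b) τ S pS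
    (pS.nodup_iff.2 hnd.2.1.2.2) (oS.imp fun h h' => h (h'.of_lower hb)) hsort.2.1.2.2
  have hL' : Steps (lower T b a) (lower T b b) L (P' ++ (i, x) :: (j, y) :: S') := by
    have h1 := hP'.context [] ((i, x) :: (j, y) :: S)
    have h2 := hS'.context (P' ++ [(i, x), (j, y)]) []
    simp only [List.append_assoc, List.cons_append, List.nil_append, List.append_nil] at h1 h2
    exact hL.trans (h1.trans h2)
  have memP : ∀ p ∈ labels P', Before a b i j p := fun p hp => by
    obtain ⟨q, hq, rfl⟩ := List.mem_map.1 (pP.subset hp)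
    exact hP q hq
  have memS : ∀ p ∈ labels S', ¬ Lt a b p i ∧ ¬ Lt a b p j := fun p hp => by
    obtain ⟨q, hq, rfl⟩ := List.mem_map.1 (pS.subset hp)
    exact hS q hq
  have hsorted : Sorted a b (labels (P' ++ (i, x) :: (j, y) :: S')) := by
    simp only [Sorted, labels, List.map_append, List.map_cons, List.pairwise_append,
      List.pairwise_cons, List.mem_cons] at oP oS ⊢
    refine ⟨oP, ⟨?_, fun q hq => (memS q hq).2, oS⟩, ?_⟩
    · rintro q (rfl | hq)
      · exact hij
      · exact (memS q hq).1
    · rintro p hp q (rfl | rfl | hq) hlt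
      · rcases memP p hp with h | h
        · exact h.asymm hlt
        · exact h.2 hlt
      · rcases memP p hp with h | h
        · exact hij (hlt.trans h)
        · exact h.1.asymm hlt
      · rcases memP p hp with h | h
        · exact (memS q hq).1 (hlt.trans h)
        · exact (memS q hq).2 (hlt.trans h.1)
  obtain ⟨M, hM, hMl⟩ := exists_steps_of_sorted _ L hL'.perm.symm
    (hL'.perm.nodup_iff.1 hn) hsorted hs
  obtain rfl := Steps.eq_of_labels_eq hn hM.lower hL' hMl
  exact hold _ _ _ _ hM

open Classical in
/-- The Lipschitz bound after lowering for a pair `i`, `j` not in reversed order, given the bound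
for the pairs preceding it: the rows separating `i` and `j` from their positions in an unlowered
reordering are moved past the pair one at a time. -/
theorem lip_lower_of_not_lt (hb : Monotone b) (hn : (labels L).Nodup) (hs : Sorted a b (labels L))
    (hold : ∀ P u v S, Steps a b L (P ++ u :: v :: S) →
      (u.2 - v.2).natAbs ≤ dist (lower T b a) (lower T b b) u.1 v.1)
    (hij : ¬ Lt a b j i)
    (ih : ∀ i' j', dist (lower T b a) (lower T b b) i' j' < dist (lower T b a) (lower T b b) i j →
      Lip (lower T b a) (lower T b b) L i' j')
    (ih' : ∀ k, Lt a b i k → Lt a b k j →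
      Lip (lower T b a) (lower T b b) L i k ∧ Lip (lower T b a) (lower T b b) L k i ∧
      Lip (lower T b a) (lower T b b) L j k ∧ Lip (lower T b a) (lower T b b) L k j) :
    Lip (lower T b a) (lower T b b) L i j := by
  have hs' : Sorted (lower T b a) (lower T b b) (labels L) :=
    hs.imp fun h h' => h (h'.of_lower hb)
  intro P x y S hL
  generalize hk : (labels P).countP (fun w => ¬ Before a b i j w) +
    (labels S).countP (fun w => Lt a b w i ∨ Lt a b w j) = k
  induction k using Nat.strong_induction_on generalizing P x y S with
  | _ k ihk =>
  have hsort := hL.sorted hs'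
  have hnd := hL.perm.nodup_iff.1 hn
  by_cases hP : ∃ w ∈ P, ¬ Before a b i j w.1
  · obtain ⟨P₁, ⟨w, z⟩, P₂, rfl, hw, hP₂⟩ := exists_last _ _ hP
    simp only [Sorted, labels, List.map_append, List.map_cons, List.append_assoc, List.cons_append,
      List.pairwise_append, List.pairwise_cons, List.mem_append, List.mem_cons, List.nodup_append,
      List.nodup_cons] at hsort hnd
    have hPlab : ∀ q ∈ P₂, q.1 ∈ P₂.map Prod.fst := fun q hq => List.mem_map_of_mem hq
    obtain ⟨⟨w', z'⟩, Q, hw', hQ, hst⟩ := bubble_right (a := lower T b a) (b := lower T b b)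
      P₂ (w, z) fun q hq => by
        have hq' := hPlab q hq
        refine nest_or_nest ?_ ?_ ?_
        · grind
        · intro hlt
          exact hw ((not_not.1 (hP₂ q hq)).of_lt (hlt.of_lower hb))
        · grind
    obtain rfl : w' = w := hw'
    have hL' : Steps (lower T b a) (lower T b b) L
        ((P₁ ++ Q) ++ (w', z') :: (i, x) :: (j, y) :: S) := by
      have := hst.context P₁ ((i, x) :: (j, y) :: S)
      simp only [List.append_assoc, List.cons_append, List.nil_append] at this hL ⊢
      exact hL.trans this
    have n1 : ¬ Lt (lower T b a) (lower T b b) i w' := by grind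
    have n2 : ¬ Lt (lower T b a) (lower T b b) j w' := by grind
    have n3 : w' ≠ i := by grind
    have n4 : w' ≠ j := by grind
    by_cases hM : Lt a b i w' ∧ Lt a b w' j
    · obtain ⟨l1, l2, -, l4⟩ := ih' w' hM.1 hM.2
      exact triangle_left hL' (nest_or_nest n3 (fun h => (h.of_lower hb).asymm hM.1) n1)
        (hM.1.dist_lower_add hM.2) l2 l1 l4
    · have m1 : ¬ Lt a b w' i := fun h => hw (.inl h)
      have m2 : ¬ Lt a b w' j := fun h => hw (.inr ⟨h, fun h' => hM ⟨h', h⟩⟩)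
      rcases cross_left hL' (nest_or_nest n3 (fun h => m1 (h.of_lower hb)) n1)
        (nest_or_nest n4 (fun h => m2 (h.of_lower hb)) n2) ih with h | ⟨x', y', z'', he, hL''⟩
      · exact h
      · rw [← he]
        refine ihk _ ?_ _ _ _ _ hL'' rfl
        have hw₂ : ¬ (Lt a b w' i ∨ Lt a b w' j) := by tauto
        rw [← hk]
        simp only [labels, List.map_append, List.map_cons, List.countP_append,
          List.countP_cons, hw, hw₂] at hQ ⊢
        rw [hQ]
        simp only [not_false_eq_true, decide_true, decide_false, if_true, Bool.false_eq_true,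
          if_false]
        omega
  by_cases hS : ∃ w ∈ S, Lt a b w.1 i ∨ Lt a b w.1 j
  · obtain ⟨S₁, ⟨w, z⟩, S₂, rfl, hw, hS₁⟩ := exists_first _ _ hS
    simp only [Sorted, labels, List.map_append, List.map_cons,
      List.pairwise_append, List.pairwise_cons, List.mem_append, List.mem_cons, List.nodup_append,
      List.nodup_cons] at hsort hnd
    have hSlab : ∀ q ∈ S₁, q.1 ∈ S₁.map Prod.fst := fun q hq => List.mem_map_of_mem hq
    obtain ⟨⟨w', z'⟩, Q, hw', hQ, hst⟩ := bubble_left (a := lower T b a) (b := lower T b b)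
      S₁ (w, z) fun q hq => by
        have hq' := hSlab q hq
        refine nest_or_nest ?_ ?_ ?_
        · grind
        · grind
        · intro hlt
          have hlt' := hlt.of_lower hb
          exact hS₁ q hq (hw.imp hlt'.trans hlt'.trans)
    obtain rfl : w' = w := hw'
    have hL' : Steps (lower T b a) (lower T b b) L
        (P ++ (i, x) :: (j, y) :: (w', z') :: (Q ++ S₂)) := by
      have := hst.context (P ++ [(i, x), (j, y)]) S₂
      simp only [List.append_assoc, List.cons_append, List.nil_append] at this hL ⊢
      exact hL.trans this
    have n1 : ¬ Lt (lower T b a) (lower T b b) w' i := by grind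
    have n2 : ¬ Lt (lower T b a) (lower T b b) w' j := by grind
    have n3 : w' ≠ i := by grind
    have n4 : w' ≠ j := by grind
    by_cases hM : Lt a b i w' ∧ Lt a b w' j
    · obtain ⟨l1, -, l3, l4⟩ := ih' w' hM.1 hM.2
      exact triangle_right hL' (nest_or_nest n4 n2 (fun h => (h.of_lower hb).asymm hM.2))
        (hM.1.dist_lower_add hM.2) l3 l4 l1
    · have m1 : ¬ Lt a b i w' := fun h => by
        rcases hw with hw | hw
        · exact h.asymm hw
        · exact hM ⟨h, hw⟩
      have m2 : ¬ Lt a b j w' := fun h => by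
        rcases hw with hw | hw
        · exact hij (h.trans hw)
        · exact h.asymm hw
      rcases cross_right hL' (nest_or_nest n3 n1 (fun h => m1 (h.of_lower hb)))
        (nest_or_nest n4 n2 (fun h => m2 (h.of_lower hb))) ih with h | ⟨x', y', z'', he, hL''⟩
      · exact h
      · rw [← he]
        refine ihk _ ?_ (P ++ [(w', z'')]) _ _ _ (by simpa using hL'') rfl
        have hw₂ : Before a b i j w' := hw.imp_right fun h => ⟨h, m1⟩
        rw [← hk]
        simp only [labels, List.map_append, List.map_cons, List.countP_append, List.map_nil,
          List.countP_nil, List.countP_cons, hw, hw₂] at hQ ⊢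
        rw [hQ]
        simp only [not_true_eq_false, decide_true, decide_false, if_true, Bool.false_eq_true,
          if_false]
        omega
  · push Not at hP hS
    exact natAbs_le_of_placed hb hn hs hold hij hL hP hS

theorem lip_lower (hb : Monotone b) (hn : (labels L).Nodup) (hs : Sorted a b (labels L))
    (hold : ∀ P u v S, Steps a b L (P ++ u :: v :: S) →
      (u.2 - v.2).natAbs ≤ dist (lower T b a) (lower T b b) u.1 v.1) (i j : ℕ) :
    Lip (lower T b a) (lower T b b) L i j := by
  have hs' : Sorted (lower T b a) (lower T b b) (labels L) :=
    hs.imp fun h h' => h (h'.of_lower hb)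
  have key : ∀ d m i j, dist (lower T b a) (lower T b b) i j = d →
      ((i : ℤ) - j).natAbs = m → Lip (lower T b a) (lower T b b) L i j := by
    intro d
    induction d using Nat.strong_induction_on with
    | _ d ihd =>
    intro m
    induction m using Nat.strong_induction_on with
    | _ m ihm =>
    have main : ∀ i j, dist (lower T b a) (lower T b b) i j = d →
        ((i : ℤ) - j).natAbs = m → ¬ Lt a b j i → Lip (lower T b a) (lower T b b) L i j := by
      intro i j hd hm hij
      refine lip_lower_of_not_lt hb hn hs hold hij (fun i' j' h => ihd _ (hd ▸ h) _ _ _ rfl rfl)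
        fun k h1 h2 => ?_
      have e := h1.dist_lower_add (T := T) h2
      have c1 := dist_comm (a := lower T b a) (b := lower T b b) i k
      have c2 := dist_comm (a := lower T b a) (b := lower T b b) k j
      have l1 := h1.label_lt hb
      have l2 := h2.label_lt hb
      have ihdm : ∀ i' j', dist (lower T b a) (lower T b b) i' j' ≤ d →
          ((i' : ℤ) - j').natAbs < m → Lip (lower T b a) (lower T b b) L i' j' := by
        intro i' j' h h'
        rcases h.lt_or_eq with h | h
        · exact ihd _ h _ _ _ rfl rfl
        · exact ihm _ h' _ _ h rfl
      exact ⟨ihdm _ _ (by omega) (by omega), ihdm _ _ (by omega) (by omega),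
        ihdm _ _ (by omega) (by omega), ihdm _ _ (by omega) (by omega)⟩
    intro i j hd hm
    by_cases hij : Lt a b j i
    · intro P x y S hL
      have hji := main j i (by rw [dist_comm, hd]) (by omega) hij.asymm
      have hsort := hL.sorted hs'
      simp only [Sorted, labels, List.map_append, List.map_cons, List.pairwise_append,
        List.pairwise_cons, List.mem_cons] at hsort
      have hnest : Nest (lower T b a) (lower T b b) i j ∨ Nest (lower T b a) (lower T b b) j i :=
        nest_or_nest (hij.label_lt hb).ne' (fun h => (h.of_lower hb).asymm hij)
          (hsort.2.1.1 j (Or.inl rfl))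
      rw [dist_comm]
      rcases hnest with h | h
      · have := hji _ _ _ _ (step_left h hL)
        omega
      · have := hji _ _ _ _ (step_right h hL)
        omega
    · exact main i j hd hm hij
  exact key _ _ i j rfl rfl

end Main

end Model

/-! ### Rows in integral coordinates -/

open Model

/-- The sign `(-1)^n`. -/
def parity (n : ℤ) : ℤ := if n % 2 = 0 then 1 else -1

theorem parity_eq (n : ℤ) : parity n = 1 ∨ parity n = -1 := by
  unfold parity; split_ifs <;> simp

theorem m1pow_intCast (n : ℤ) : m1pow (n : ℚ) = parity n := by
  simp [m1pow, parity]

/-- The row with segment `[t + a, t + b]`. -/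
def intRow (t : ℚ) (a b l η : ℤ) : Row := ⟨t + a, t + b, l, η⟩

section IntRow

variable {t : ℚ} {a b l η a' b' l' η' : ℤ}

theorem m1pow_intRow : m1pow ((intRow t a b l η).A - (intRow t a b l η).B) =
    parity (a - b) := by
  rw [← m1pow_intCast]; congr 1; simp [intRow]

theorem m1pow_intRow_add_one : m1pow ((intRow t a b l η).A - (intRow t a b l η).B + 1) =
    -parity (a - b) := by
  have : (intRow t a b l η).A - (intRow t a b l η).B + 1 = ((a - b + 1 : ℤ) : ℚ) := by
    simp [intRow]
  rw [this, m1pow_intCast, parity, parity]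
  split_ifs <;> omega

theorem intRow_b : (intRow t a b l η).b = ((a - b + 1 : ℤ) : ℚ) := by
  simp [intRow, Row.b]

theorem intRow_subseg :
    (intRow t a b l η).subseg (intRow t a' b' l' η') ↔ b' ≤ b ∧ a ≤ a' := by
  simp [intRow, Row.subseg]

theorem base_add (t : ℚ) (x y : ℤ) : t + x + y = t + ((x + y : ℤ) : ℚ) := by
  push_cast; ring

theorem base_sub (t : ℚ) (x y : ℤ) : t + x - y = t + ((x - y : ℤ) : ℚ) := by
  push_cast; ring

theorem xuPair_intRow : XuPair (intRow t a b l η) (intRow t a' b' l' η') ↔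
    ((a ≤ a' ∧ b ≤ b') →
      (parity (a - b) * η * η' = 1 → b + l ≤ b' + l' ∧ a - l ≤ a' - l') ∧
      (parity (a - b) * η * η' = -1 → a - l < b' + l')) ∧
    (((b' ≤ b ∧ a ≤ a') ∧ ¬ (b ≤ b' ∧ a' ≤ a)) →
      (parity (a - b) * η * η' = 1 →
        0 ≤ l' - l ∧ l' - l ≤ a' - b' + 1 - (a - b + 1)) ∧
      (parity (a - b) * η * η' = -1 → a - b + 1 ≤ l + l')) ∧
    (((b ≤ b' ∧ a' ≤ a) ∧ ¬ (b' ≤ b ∧ a ≤ a')) →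
      (parity (a - b) * η * η' = 1 →
        0 ≤ l - l' ∧ l - l' ≤ a - b + 1 - (a' - b' + 1)) ∧
      (parity (a - b) * η * η' = -1 → a' - b' + 1 ≤ l + l')) := by
  rw [XuPair, m1pow_intRow, intRow_subseg, intRow_subseg, intRow_b, intRow_b]
  simp only [intRow, base_add, base_sub, add_le_add_iff_left, add_lt_add_iff_left]
  norm_cast

theorem uiApplicablePair_intRow : uiApplicablePair (intRow t a b l η) (intRow t a' b' l' η') ↔
    a < a' ∧ b < b' ∧
      ((parity (a - b) * η * η' = 1 ∧
          (a' - l' = a - l ∨ b' + l' = b + l)) ∨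
        (parity (a - b) * η * η' = -1 ∧ b' + l' = a - l + 1)) := by
  rw [uiApplicablePair, m1pow_intRow]
  have h : t + ((a - l : ℤ) : ℚ) + 1 = t + ((a - l + 1 : ℤ) : ℚ) := by push_cast; ring
  simp only [intRow, base_add, base_sub, h, add_lt_add_iff_left, add_right_inj]
  norm_cast

end IntRow

/-- The row `r`, preceded by rows of total sign `z`, corresponds to the entry `p`. -/
def Rep (t : ℚ) (a b : ℕ → ℤ) (z : ℤ) (r : Row) (p : ℕ × ℤ) : Prop :=
  ∃ l η : ℤ, r = intRow t (a p.1) (b p.1) l η ∧ (η = 1 ∨ η = -1) ∧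
    0 ≤ a p.1 - b p.1 + 1 - 2 * l ∧ p.2 = z * η * (a p.1 - b p.1 + 1 - 2 * l)

section Rep

variable {t : ℚ} {a b : ℕ → ℤ} {z : ℤ} {r s : Row} {p q : ℕ × ℤ}

theorem Rep.even (hr : Rep t a b z r p) (hz : z = 1 ∨ z = -1) :
    Even (p.2 - (a p.1 - b p.1 + 1)) := by
  obtain ⟨l, η, -, hη, -, hx⟩ := hr
  rw [hx, Int.even_iff]
  rcases hz with rfl | rfl <;> rcases hη with rfl | rfl <;> omega

theorem Rep.xuPair_iff (hr : Rep t a b z r p) (hz : z = 1 ∨ z = -1)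
    (hs : Rep t a b (z * parity (a p.1 - b p.1)) s q) (h : ¬ (a q.1 < a p.1 ∧ b q.1 < b p.1)) :
    XuPair r s ↔ (p.2 - q.2).natAbs ≤ dist a b p.1 q.1 := by
  obtain ⟨l, η, rfl, hη, hc, hx⟩ := hr
  obtain ⟨l', η', rfl, hη', hc', hx'⟩ := hs
  rw [xuPair_intRow, hx, hx', Model.dist]
  have hm := parity_eq (a p.1 - b p.1)
  generalize parity (a p.1 - b p.1) = m at *
  clear hx hx'
  generalize a p.1 = a₁, b p.1 = b₁, a q.1 = a₂, b q.1 = b₂ at *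
  rcases hη with rfl | rfl <;> rcases hη' with rfl | rfl <;> rcases hm with rfl | rfl <;>
    rcases hz with rfl | rfl <;> norm_num <;> constructor <;> intro H <;> omega

theorem Rep.uiApplicablePair (hr : Rep t a b z r p) (hz : z = 1 ∨ z = -1)
    (hs : Rep t a b (z * parity (a p.1 - b p.1)) s q) (ha : a p.1 < a q.1) (hb : b p.1 < b q.1)
    (h : (p.2 - q.2).natAbs = dist a b p.1 q.1) : uiApplicablePair r s := by
  obtain ⟨l, η, rfl, hη, hc, hx⟩ := hr
  obtain ⟨l', η', rfl, hη', hc', hx'⟩ := hs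
  rw [hx, hx', Model.dist] at h
  rw [uiApplicablePair_intRow]
  rcases hz with rfl | rfl <;> rcases parity_eq (a p.1 - b p.1) with hm | hm <;>
    rcases hη with rfl | rfl <;> rcases hη' with rfl | rfl <;> rw [hm] at h ⊢ <;> omega

theorem parity_mul_self (n : ℤ) : parity n * parity n = 1 := by
  rcases parity_eq n with h | h <;> rw [h] <;> rfl

theorem sign_mul {x y : ℤ} (hx : x = 1 ∨ x = -1) (hy : y = 1 ∨ y = -1) :
    x * y = 1 ∨ x * y = -1 := by
  rcases hx with rfl | rfl <;> rcases hy with rfl | rfl <;> simp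

theorem sign_neg {x : ℤ} (hx : x = 1 ∨ x = -1) : -x = 1 ∨ -x = -1 := by
  rcases hx with rfl | rfl <;> simp

theorem sign_eq_of_mul {k h : ℤ} (hk : k = 1 ∨ k = -1) (hh : h = 1 ∨ h = -1) :
    (k * h = 1 → h = k) ∧ (k * h ≠ 1 → h = -k) := by
  rcases hk with rfl | rfl <;> rcases hh with rfl | rfl <;> simp

/-- A row exchange with the second segment containing the first one. -/
theorem Rep.rexPair_right (hr : Rep t a b z r p)
    (hs : Rep t a b (z * parity (a p.1 - b p.1)) s q)
    (h : b q.1 ≤ b p.1 ∧ a p.1 ≤ a q.1) :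
    Rep t a b z (rexPair r s).1 (q.1, 2 * p.2 - q.2) ∧
      Rep t a b (z * parity (a q.1 - b q.1)) (rexPair r s).2 p := by
  obtain ⟨l, η, rfl, hη, hc, hx⟩ := hr
  obtain ⟨l', η', rfl, hη', hc', hx'⟩ := hs
  have hm := parity_eq (a p.1 - b p.1)
  have hsign := sign_eq_of_mul (sign_mul hm hη') hη
  have hlt : ((a q.1 - b q.1 + 1 : ℤ) : ℚ) - 2 * (l' : ℚ) <
      2 * (((a p.1 - b p.1 + 1 : ℤ) : ℚ) - 2 * (l : ℚ)) ↔
      a q.1 - b q.1 + 1 - 2 * l' < 2 * (a p.1 - b p.1 + 1 - 2 * l) := by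
    norm_cast
  rw [rexPair, if_pos (intRow_subseg.2 h), m1pow_intRow, m1pow_intRow, m1pow_intRow_add_one,
    intRow_b, intRow_b]
  simp only [intRow, hlt, mul_right_comm _ η η']
  simp only [Rep, hx, hx']
  generalize parity (a p.1 - b p.1) = m at *
  constructor
  · split_ifs with h1 h2
    · refine ⟨a q.1 - b q.1 + 1 - (l' + (a p.1 - b p.1 + 1 - 2 * l)), m * η',
        by simp [intRow], sign_mul hm hη', by omega, ?_⟩
      rw [hsign.1 h1]; ring
    · refine ⟨l' + (a p.1 - b p.1 + 1 - 2 * l), -m * η', by simp [intRow],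
        sign_mul (sign_neg hm) hη', by omega, ?_⟩
      rw [hsign.1 h1]; ring
    · refine ⟨l' - (a p.1 - b p.1 + 1 - 2 * l), -m * η', by simp [intRow],
        sign_mul (sign_neg hm) hη', by omega, ?_⟩
      rw [hsign.2 h1]; ring
  · refine ⟨l, parity (a q.1 - b q.1) * η, by simp [intRow], sign_mul (parity_eq _) hη, hc, ?_⟩
    linear_combination (-z * η * (a p.1 - b p.1 + 1 - 2 * l)) * parity_mul_self (a q.1 - b q.1)

/-- A row exchange with the first segment strictly containing the second one. -/
theorem Rep.rexPair_left (hr : Rep t a b z r p)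
    (hs : Rep t a b (z * parity (a p.1 - b p.1)) s q) (h : Nest a b p.1 q.1) :
    Rep t a b z (rexPair r s).1 q ∧
      Rep t a b (z * parity (a q.1 - b q.1)) (rexPair r s).2 (p.1, 2 * q.2 - p.2) := by
  obtain ⟨l, η, rfl, hη, hc, hx⟩ := hr
  obtain ⟨l', η', rfl, hη', hc', hx'⟩ := hs
  have hm := parity_eq (a p.1 - b p.1)
  have hm' := parity_eq (a q.1 - b q.1)
  have hsq := parity_mul_self (a q.1 - b q.1)
  have hsign := sign_eq_of_mul (sign_mul hm hη') hη
  have hlt : ((a p.1 - b p.1 + 1 : ℤ) : ℚ) - 2 * (l : ℚ) <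
      2 * (((a q.1 - b q.1 + 1 : ℤ) : ℚ) - 2 * (l' : ℚ)) ↔
      a p.1 - b p.1 + 1 - 2 * l < 2 * (a q.1 - b q.1 + 1 - 2 * l') := by
    norm_cast
  have hnot : ¬ (intRow t (a p.1) (b p.1) l η).subseg (intRow t (a q.1) (b q.1) l' η') := by
    rw [intRow_subseg]; unfold Nest at h; omega
  rw [rexPair, if_neg hnot, m1pow_intRow, m1pow_intRow, m1pow_intRow_add_one, intRow_b, intRow_b]
  simp only [intRow, hlt, mul_right_comm _ η η']
  simp only [Rep, hx, hx']
  generalize parity (a p.1 - b p.1) = m at *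
  generalize parity (a q.1 - b q.1) = m' at *
  constructor
  · exact ⟨l', m * η', by simp [intRow], sign_mul hm hη', hc', by ring⟩
  · split_ifs with h1 h2
    · refine ⟨a p.1 - b p.1 + 1 - (l + (a q.1 - b q.1 + 1 - 2 * l')), m' * η,
        by simp [intRow], sign_mul hm' hη, by omega, ?_⟩
      rw [hsign.1 h1]
      linear_combination (-z * m * η' * (2 * (a q.1 - b q.1 + 1 - 2 * l') -
        (a p.1 - b p.1 + 1 - 2 * l))) * hsq
    · refine ⟨l + (a q.1 - b q.1 + 1 - 2 * l'), -m' * η, by simp [intRow],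
        sign_mul (sign_neg hm') hη, by omega, ?_⟩
      rw [hsign.1 h1]
      linear_combination (-z * m * η' * (2 * (a q.1 - b q.1 + 1 - 2 * l') -
        (a p.1 - b p.1 + 1 - 2 * l))) * hsq
    · refine ⟨l - (a q.1 - b q.1 + 1 - 2 * l'), -m' * η, by simp [intRow],
        sign_mul (sign_neg hm') hη, by omega, ?_⟩
      rw [hsign.2 h1]
      linear_combination (-z * m * η' * (2 * (a q.1 - b q.1 + 1 - 2 * l') +
        (a p.1 - b p.1 + 1 - 2 * l))) * hsq

end Rep


/-- The rows `F`, preceded by rows of total sign `z`, correspond to the entries `L`. -/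
inductive Rel (t : ℚ) (a b : ℕ → ℤ) : ℤ → List Row → List (ℕ × ℤ) → Prop
  | nil (z : ℤ) : Rel t a b z [] []
  | cons {z : ℤ} {r : Row} {p : ℕ × ℤ} {F : List Row} {L : List (ℕ × ℤ)} (hr : Rep t a b z r p)
      (h : Rel t a b (z * parity (a p.1 - b p.1)) F L) : Rel t a b z (r :: F) (p :: L)

section Rel

variable {t : ℚ} {a b : ℕ → ℤ} {z : ℤ} {F G : List Row} {L M : List (ℕ × ℤ)}

/-- A correspondence splits at two adjacent entries, and these may be replaced by two others of
the same total sign. -/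
theorem Rel.split_entries {P S : List (ℕ × ℤ)} {p q : ℕ × ℤ} (hz : z = 1 ∨ z = -1)
    (h : Rel t a b z F (P ++ p :: q :: S)) :
    ∃ (F₁ F₂ : List Row) (r s : Row) (w : ℤ), F = F₁ ++ r :: s :: F₂ ∧
      F₁.length = P.length ∧ (w = 1 ∨ w = -1) ∧ Rep t a b w r p ∧
      Rep t a b (w * parity (a p.1 - b p.1)) s q ∧
      ∀ r' s' p' q', Rep t a b w r' p' → Rep t a b (w * parity (a p'.1 - b p'.1)) s' q' →
        parity (a p'.1 - b p'.1) * parity (a q'.1 - b q'.1) =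
          parity (a p.1 - b p.1) * parity (a q.1 - b q.1) →
        Rel t a b z (F₁ ++ r' :: s' :: F₂) (P ++ p' :: q' :: S) := by
  induction P generalizing z F with
  | nil =>
    cases h with | cons hr h =>
    cases h with | cons hs h =>
    refine ⟨[], _, _, _, z, rfl, rfl, hz, hr, hs, fun r' s' p' q' hr' hs' he => ?_⟩
    refine .cons hr' (.cons hs' ?_)
    rwa [mul_assoc, he, ← mul_assoc]
  | cons p₀ P ih =>
    cases h with | cons hr h =>
    obtain ⟨F₁, F₂, r, s, w, rfl, hl, hw, h₁, h₂, H⟩ := ih (sign_mul hz (parity_eq _)) h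
    exact ⟨_ :: F₁, F₂, r, s, w, rfl, by simp [hl], hw, h₁, h₂,
      fun r' s' p' q' hr' hs' he => .cons hr (H r' s' p' q' hr' hs' he)⟩

theorem Rel.split_rows {F₁ F₂ : List Row} {r s : Row}
    (h : Rel t a b z (F₁ ++ r :: s :: F₂) L) :
    ∃ (P S : List (ℕ × ℤ)) (p q : ℕ × ℤ), L = P ++ p :: q :: S ∧ P.length = F₁.length := by
  induction F₁ generalizing z L with
  | nil =>
    cases h with | cons hr h =>
    cases h with | cons hs h =>
    exact ⟨[], _, _, _, rfl, rfl⟩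
  | cons r₀ F₁ ih =>
    cases h with | cons hr h =>
    obtain ⟨P, S, p, q, rfl, hl⟩ := ih h
    exact ⟨_ :: P, S, p, q, rfl, by simp [hl]⟩

theorem rex_append (P S : List Row) (r s : Row) (h : r.subseg s ∨ s.subseg r) :
    rex P.length (P ++ r :: s :: S) = P ++ (rexPair r s).1 :: (rexPair r s).2 :: S := by
  simp [rex, h]

theorem rex_eq_or (k : ℕ) (F : List Row) : rex k F = F ∨ ∃ P r s S, F = P ++ r :: s :: S ∧
    (r.subseg s ∨ s.subseg r) ∧ rex k F = P ++ (rexPair r s).1 :: (rexPair r s).2 :: S := by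
  by_cases hk : k + 1 < F.length
  · have hF : F = F.take k ++ F[k] :: F[k + 1] :: F.drop (k + 2) := by
      rw [← List.drop_eq_getElem_cons, ← List.drop_eq_getElem_cons, List.take_append_drop]
    by_cases h : F[k].subseg F[k + 1] ∨ F[k + 1].subseg F[k]
    · exact .inr ⟨_, _, _, _, hF, h, by simp [rex, hk, Nat.lt_of_succ_lt hk, h]⟩
    · exact .inl (by simp [rex, hk, Nat.lt_of_succ_lt hk, h])
  · have : F[k + 1]? = none := by simpa using hk
    left; unfold rex; rw [this]; split <;> simp_all

theorem Rep.subseg_iff {z w : ℤ} {r s : Row} {p q : ℕ × ℤ} (hr : Rep t a b z r p)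
    (hs : Rep t a b w s q) : r.subseg s ↔ b q.1 ≤ b p.1 ∧ a p.1 ≤ a q.1 := by
  obtain ⟨l, η, rfl, -⟩ := hr
  obtain ⟨l', η', rfl, -⟩ := hs
  exact intRow_subseg

theorem Rel.step (h : Rel t a b z F L) (hz : z = 1 ∨ z = -1) (hs : Step a b L M) :
    ∃ G, ReorderStep F G ∧ Rel t a b z G M := by
  cases hs with
  | left P S i j x y hn =>
    obtain ⟨F₁, F₂, r, s, w, rfl, -, -, hr, hs, H⟩ := h.split_entries hz
    have h' := hr.rexPair_left hs hn
    refine ⟨_, ⟨F₁.length, (rex_append _ _ _ _ (.inr ?_)).symm⟩,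
      H _ _ _ _ h'.1 h'.2 (mul_comm _ _)⟩
    rw [hs.subseg_iff hr]; unfold Nest at hn; exact ⟨hn.2.1, hn.1⟩
  | right P S i j x y hn =>
    obtain ⟨F₁, F₂, r, s, w, rfl, -, -, hr, hs, H⟩ := h.split_entries hz
    have h' := hr.rexPair_right hs ⟨hn.2.1, hn.1⟩
    refine ⟨_, ⟨F₁.length, (rex_append _ _ _ _ (.inl ?_)).symm⟩,
      H _ _ _ _ h'.1 h'.2 (mul_comm _ _)⟩
    rw [hr.subseg_iff hs]; exact ⟨hn.2.1, hn.1⟩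

/-- Exchanges of entries lift to row exchanges. -/
theorem Rel.steps (h : Rel t a b z F L) (hz : z = 1 ∨ z = -1) (hs : Steps a b L M) :
    ∃ G, Reorder F G ∧ Rel t a b z G M := by
  induction hs with
  | refl => exact ⟨F, .refl, h⟩
  | tail _ hs ih =>
    obtain ⟨G, hG, hR⟩ := ih
    obtain ⟨G', hG', hR'⟩ := hR.step hz hs
    exact ⟨G', hG.tail hG', hR'⟩

theorem Rel.rex (h : Rel t a b z F L) (hz : z = 1 ∨ z = -1) (k : ℕ)
    (hL : ∀ P i j x y S, L = P ++ (i, x) :: (j, y) :: S → (x - y).natAbs ≤ dist a b i j) :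
    ∃ M, Steps a b L M ∧ Rel t a b z (rex k F) M := by
  obtain hk | ⟨F₁, r, s, F₂, rfl, hsub, hk⟩ := rex_eq_or k F
  · exact ⟨L, .refl, by rwa [hk]⟩
  obtain ⟨P, S, ⟨i, x⟩, ⟨j, y⟩, rfl, hlen⟩ := h.split_rows
  obtain ⟨F₁', F₂', r', s', w, he, hlen', -, hr, hs, H⟩ := h.split_entries hz
  obtain ⟨rfl, he'⟩ := List.append_inj he (hlen.symm.trans hlen'.symm)
  obtain ⟨rfl, rfl, rfl⟩ : r = r' ∧ s = s' ∧ F₂ = F₂' := by simpa using he'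
  rw [hk]
  by_cases hn : Nest a b i j
  · have h' := hr.rexPair_left hs hn
    exact ⟨_, .single (.left P S i j x y hn), H _ _ _ _ h'.1 h'.2 (mul_comm _ _)⟩
  have hle : b j ≤ b i ∧ a i ≤ a j := by
    rw [hr.subseg_iff hs, hs.subseg_iff hr] at hsub
    unfold Nest at hn
    simp only at hsub
    omega
  have h' := hr.rexPair_right hs hle
  by_cases hn' : Nest a b j i
  · exact ⟨_, .single (.right P S i j x y hn'), H _ _ _ _ h'.1 h'.2 (mul_comm _ _)⟩
  have hab : a j = a i ∧ b j = b i := by unfold Nest at hn'; omega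
  have hxy : y = x := by
    have := hL P i j x y S rfl
    unfold Model.dist at this; omega
  subst hxy
  refine ⟨_, .refl, H _ _ (i, y) (j, y) ?_ ?_ rfl⟩
  · simpa [Rep, hab, two_mul] using h'.1
  · simpa [Rep, hab] using h'.2

/-- Row exchanges descend to exchanges of entries, as long as the latter satisfy the Lipschitz
condition. -/
theorem Rel.reorder (h : Rel t a b z F L) (hz : z = 1 ∨ z = -1) (hL : ∀ i j, Lip a b L i j)
    (hG : Reorder F G) : ∃ M, Steps a b L M ∧ Rel t a b z G M := by
  induction hG with
  | refl => exact ⟨L, .refl, h⟩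
  | tail _ hs ih =>
    obtain ⟨M, hM, hR⟩ := ih
    obtain ⟨k, rfl⟩ := hs
    obtain ⟨M', hM', hR'⟩ := hR.rex hz k fun P i j x y S he => hL i j P x y S (he ▸ hM)
    exact ⟨M', hM.trans hM', hR'⟩

end Rel


section Rel

variable {t : ℚ} {a b : ℕ → ℤ} {z : ℤ} {F : List Row} {L : List (ℕ × ℤ)}

theorem Rel.xuAll (h : Rel t a b z F L) (hz : z = 1 ∨ z = -1) (hs : Sorted a b (labels L))
    (hL : ∀ P p q S, L = P ++ p :: q :: S → (p.2 - q.2).natAbs ≤ dist a b p.1 q.1) :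
    XuAll F := by
  unfold XuAll
  induction h with
  | nil => exact .nil
  | @cons z r p F L hr h ih =>
    replace ih := ih (sign_mul hz (parity_eq _)) (List.Pairwise.of_cons hs)
      fun P p' q S he => hL (p :: P) p' q S (by rw [he]; rfl)
    cases h with
    | nil => exact .singleton _
    | @cons _ s q F L hs' h =>
      refine .cons_cons ((hr.xuPair_iff hz hs' fun hlt => ?_).2 (hL [] p q L rfl)) ih
      exact List.rel_of_pairwise_cons hs (List.mem_cons_self) (.inl hlt)

theorem not_lt_of_sorted {P S : List (ℕ × ℤ)} {p q : ℕ × ℤ}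
    (h : Sorted a b (labels (P ++ p :: q :: S))) : ¬ Lt a b q.1 p.1 := by
  simp only [Sorted, labels, List.map_append, List.map_cons, List.pairwise_append,
    List.pairwise_cons] at h
  exact h.2.1.1 _ List.mem_cons_self

theorem Rel.shAll (d : ℤ) (h : Rel t a b z F L) : Rel (t + d) a b z (shAll d F) L := by
  induction h with
  | nil => exact .nil _
  | cons hr _ ih =>
    obtain ⟨l, η, rfl, h⟩ := hr
    refine .cons ⟨l, η, ?_, h⟩ ih
    simp [intRow, Row.sh, add_right_comm]

theorem lower_sub_lower (T : ℤ) (a b : ℕ → ℤ) (i : ℕ) :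
    lower T b a i - lower T b b i = a i - b i := by
  unfold lower; split_ifs <;> omega

theorem Rel.shiftGE {B : ℚ} {T : ℤ} (hT : ∀ n : ℤ, T ≤ n ↔ B ≤ t + n) (h : Rel t a b z F L) :
    Rel t (lower T b a) (lower T b b) z (shiftGE B F) L := by
  induction h with
  | nil => exact .nil _
  | @cons z r p F L hr _ ih =>
    refine .cons ?_ (by rwa [lower_sub_lower])
    obtain ⟨l, η, rfl, h⟩ := hr
    refine ⟨l, η, ?_, by rwa [lower_sub_lower]⟩
    by_cases h0 : B ≤ t + b p.1
    · simp [lower, hT, intRow, h0, Row.sh, add_sub_assoc, ← sub_eq_add_neg]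
    · simp [lower, hT, intRow, h0]

theorem exists_rel (F : List Row) (k : ℕ) (hz : z = 1 ∨ z = -1)
    (hF : ∀ (i : ℕ) (h : i < F.length), F[i].A = t + a (k + i) ∧ F[i].B = t + b (k + i))
    (hl : ∀ r ∈ F, (∃ l : ℤ, r.l = l) ∧ (r.eta = 1 ∨ r.eta = -1) ∧ r.l ≤ r.b / 2) :
    ∃ L, labels L = List.range' k F.length ∧ Rel t a b z F L := by
  induction F generalizing k z with
  | nil => exact ⟨[], rfl, .nil _⟩
  | cons r F ih =>
    obtain ⟨L, hL, hR⟩ := ih (k + 1) (sign_mul hz (parity_eq (a k - b k)))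
      (fun i hi => by rw [add_assoc, add_comm 1]; exact hF (i + 1) (Nat.succ_lt_succ hi))
      (fun r hr => hl r (by simp [hr]))
    obtain ⟨⟨l, hrl⟩, hη, hb⟩ := hl r (by simp)
    obtain ⟨hA, hB⟩ : r.A = t + a k ∧ r.B = t + b k := hF 0 (by simp)
    refine ⟨(k, z * r.eta * (a k - b k + 1 - 2 * l)) :: L, congrArg (k :: ·) hL,
      .cons ⟨l, r.eta, ?_, hη, ?_, rfl⟩ hR⟩
    · rw [intRow, ← hA, ← hB, ← hrl]
    · rw [Row.b, hA, hB, hrl, le_div_iff₀ two_pos] at hb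
      have : (l : ℚ) * 2 ≤ ((a k - b k + 1 : ℤ) : ℚ) := by push_cast; linarith
      norm_cast at this
      simp only
      omega

end Rel

theorem isInt_iff {x : ℚ} : IsInt x ↔ ∃ n : ℤ, x = n := by
  refine ⟨fun h => ⟨x.num, ?_⟩, ?_⟩
  · exact (Rat.den_eq_one_iff x).1 h |>.symm
  · rintro ⟨n, rfl⟩
    simp [IsInt]

/-- Integral coordinates for an extended multi-segment datum. -/
theorem exists_coordinates {E : List Row} (hE : IsEMS E) (hP : Pprime E) :
    ∃ (t : ℚ) (a b : ℕ → ℤ) (L : List (ℕ × ℤ)), Monotone b ∧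
      labels L = List.range' 0 E.length ∧ Rel t a b 1 E L := by
  obtain rfl | hne := eq_or_ne E []
  · exact ⟨0, 0, 0, [], monotone_const, rfl, .nil _⟩
  have hpos : 0 < E.length := List.length_pos_iff.2 hne
  have hlt (i : ℕ) : min i (E.length - 1) < E.length := by omega
  have hcoord (i : ℕ) : ∃ α β : ℤ, E[min i (E.length - 1)].A = E[0].A + α ∧
      E[min i (E.length - 1)].B = E[0].A + β := by
    obtain ⟨n, hn⟩ := isInt_iff.1
      (hE.1.2.2.1 _ (List.getElem_mem (hlt i)) _ (List.getElem_mem hpos))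
    obtain ⟨-, -, ⟨m, hm⟩, -⟩ := hE.1.1 _ (List.getElem_mem (hlt i))
    exact ⟨n, n - m, by linarith, by push_cast; linarith⟩
  choose a b hab using hcoord
  have hb : Monotone b := by
    intro i j hij
    have : E[min i (E.length - 1)].B ≤ E[min j (E.length - 1)].B := by
      obtain h | h := (min_le_min_right (E.length - 1) hij).eq_or_lt
      · simp only [h]; rfl
      · exact List.pairwise_iff_getElem.1 hP _ _ (hlt i) (hlt j) h
    rw [(hab i).2, (hab j).2] at this
    exact_mod_cast (add_le_add_iff_left _).1 this
  obtain ⟨L, hL, hR⟩ := exists_rel (t := E[0].A) (a := a) (b := b) E 0 (.inl rfl)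
    (fun i hi => by simpa [Nat.min_eq_left (Nat.le_sub_one_of_lt hi)] using hab i)
    (fun r hr => ⟨isInt_iff.1 (hE.1.1 r hr).2.2.2.1, (hE.1.1 r hr).2.2.2.2, (hE.2 r hr).2⟩)
  exact ⟨_, a, b, L, hb, hL, hR⟩

theorem exists_natCast_add_nonneg (E : List Row) : ∃ d : ℕ, ∀ r ∈ E, 0 ≤ r.B + (d : ℚ) := by
  induction E with
  | nil => exact ⟨0, by simp⟩
  | cons r E ih =>
    obtain ⟨d, hd⟩ := ih
    obtain ⟨m, hm⟩ := exists_nat_ge (-r.B)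
    refine ⟨d + m, fun s hs => ?_⟩
    push_cast
    obtain rfl | hs := List.mem_cons.1 hs
    · have : (0 : ℚ) ≤ d := d.cast_nonneg
      linarith
    · have : (0 : ℚ) ≤ m := m.cast_nonneg
      linarith [hd s hs]

/-- In a reordering of a minimal non-vanishing datum, the values at adjacent rows differ by at
most the distance of the lowered segments. -/
theorem natAbs_le_dist_lower_of_minimal {E : List Row} {t : ℚ} {a b : ℕ → ℤ}
    {L P S : List (ℕ × ℤ)} {p q : ℕ × ℤ} (T : ℤ) (hNV : NonVanishing E) (hmin : MinimalP E)
    (hR : Rel t a b 1 E L) (hs : Sorted a b (labels L)) (hL : Steps a b L (P ++ p :: q :: S)) :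
    (p.2 - q.2).natAbs ≤ dist (lower T b a) (lower T b b) p.1 q.1 := by
  have hlt : ¬ Lt a b q.1 p.1 := not_lt_of_sorted (hL.sorted hs)
  obtain ⟨d, hd⟩ := exists_natCast_add_nonneg E
  obtain ⟨G, hG, hRG⟩ := (hR.shAll d).steps (.inl rfl) hL
  obtain ⟨F₁, F₂, r, s, w, rfl, -, hw, hr, hs, -⟩ := hRG.split_entries (.inl rfl)
  obtain ⟨G', hG', hRG'⟩ := hR.steps (.inl rfl) hL
  obtain ⟨F₁', F₂', r', s', w', rfl, -, hw', hr', hs', -⟩ := hRG'.split_entries (.inl rfl)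
  refine natAbs_le_dist_lower hlt ?_ (fun ha hb he => ?_) (hr.even hw)
    (hs.even (sign_mul hw (parity_eq _)))
  · refine (hr.xuPair_iff hw hs fun h => hlt (.inl h)).1 ?_
    exact (List.isChain_append_cons_cons.1 (hNV.2 d hd _ hG)).2.1
  · exact hmin _ hG' F₁'.length r' s' (by simp) (by simp)
      (hr'.uiApplicablePair hw' hs' ha hb he)

theorem xuAll_of_reorder_shiftGE {E F : List Row} (hE : IsEMS E) (hNV : NonVanishing E)
    (hP : Pprime E) (hmin : MinimalP E) (B : ℚ) (d : ℤ) (hF : Reorder (shAll d (shiftGE B E)) F) :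
    XuAll F := by
  obtain ⟨t, a, b, L, hb, hL, hR⟩ := exists_coordinates hE hP
  have hle : (labels L).Pairwise (· ≤ ·) := by
    rw [hL]; exact List.pairwise_le_range'
  have hT (n : ℤ) : ⌈B - t⌉ ≤ n ↔ B ≤ t + n := by rw [Int.ceil_le, sub_le_iff_le_add']
  have hlower : Monotone (lower ⌈B - t⌉ b b) := by
    intro i j hij
    have := hb hij
    unfold lower; split_ifs <;> omega
  have hlip := lip_lower (T := ⌈B - t⌉) hb (by rw [hL]; exact List.nodup_range')
    (sorted_of_pairwise_le hb hle) fun P u v S hS =>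
      natAbs_le_dist_lower_of_minimal _ hNV hmin hR (sorted_of_pairwise_le hb hle) hS
  obtain ⟨M, hM, hRM⟩ := ((hR.shiftGE hT).shAll d).reorder (.inl rfl) hlip hF
  refine hRM.xuAll (.inl rfl) (hM.sorted (sorted_of_pairwise_le hlower hle)) fun P p q S he => ?_
  subst he
  exact hlip p.1 q.1 P p.2 q.2 S hM

theorem one_le_of_isInt_two_mul {x B : ℚ} (hB : 1 / 2 < B) (hx : IsInt (2 * x)) (h : B ≤ x) :
    1 ≤ x := by
  obtain ⟨n, hn⟩ := isInt_iff.1 hx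
  have : (1 : ℚ) < n := by linarith
  have : (2 : ℚ) ≤ n := by exact_mod_cast this
  linarith

theorem isEMS_shiftGE {E : List Row} (hE : IsEMS E) (hP : Pprime E) {B : ℚ} (hB : 1 / 2 < B) :
    IsEMS (shiftGE B E) := by
  obtain ⟨⟨hES, hsum, hdiff, -⟩, hl⟩ := hE
  unfold shiftGE
  refine ⟨⟨?_, ?_, ?_, ?_⟩, ?_⟩
  · simp only [List.forall_mem_map]
    intro r hr
    split_ifs
    · obtain ⟨hA, hB, ⟨n, hn⟩, h⟩ := hES r hr
      obtain ⟨m, hm⟩ := isInt_iff.1 hA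
      obtain ⟨k, hk⟩ := isInt_iff.1 hB
      refine ⟨isInt_iff.2 ⟨m - 2, ?_⟩, isInt_iff.2 ⟨k - 2, ?_⟩, ⟨n, ?_⟩, h⟩ <;>
        simp only [Row.sh] <;> push_cast <;> linarith
    · exact hES r hr
  · simp only [List.forall_mem_map]
    intro r hr
    split_ifs with h
    · obtain ⟨-, hB', ⟨n, hn⟩, -⟩ := hES r hr
      have := one_le_of_isInt_two_mul hB hB' h
      have : (0 : ℚ) ≤ n := n.cast_nonneg
      simp only [Row.sh]; push_cast; linarith
    · exact hsum r hr
  · simp only [List.forall_mem_map]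
    intro r hr s hs
    obtain ⟨n, hn⟩ := isInt_iff.1 (hdiff r hr s hs)
    rw [isInt_iff]
    split_ifs
    · exact ⟨n, by simp only [Row.sh]; linarith⟩
    · exact ⟨n - 1, by simp only [Row.sh]; push_cast; linarith⟩
    · exact ⟨n + 1, by simp only [Row.sh]; push_cast; linarith⟩
    · exact ⟨n, hn⟩
  · rw [List.pairwise_map]
    refine List.Pairwise.imp_of_mem (fun {r s} hr hs hrs => ?_) hP
    rintro ⟨-, h⟩
    simp only [Row.sh] at h
    split_ifs at h with h₁ h₂ h₂ <;> push_cast at h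
    · linarith
    · obtain ⟨n, hn⟩ := isInt_iff.1 (hdiff s hs r hr)
      obtain ⟨-, -, ⟨m, hm⟩, -⟩ := hES r hr
      obtain ⟨k, hk⟩ := hES s hs |>.2.2.1
      have hd : s.B - r.B = ((n + m - k : ℤ) : ℚ) := by push_cast; linarith
      have h0 : (0 : ℚ) < ((n + m - k : ℤ) : ℚ) := by rw [← hd]; linarith
      have h1 : (1 : ℚ) ≤ ((n + m - k : ℤ) : ℚ) := by exact_mod_cast h0
      linarith
    · linarith
    · linarith
  · simp only [List.forall_mem_map]
    intro r hr
    have := hl r hr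
    split_ifs
    · simpa [Row.sh, Row.b] using this
    · exact this

theorem starCond_shiftGE {E : List Row} (hE : IsEMS E) (hE' : StarCond E) (hP : Pprime E) {B : ℚ}
    (hB : 1 / 2 < B) : StarCond (shiftGE B E) := by
  intro i r' hi
  rw [shiftGE, List.getElem?_map, Option.map_eq_some_iff] at hi
  obtain ⟨r, hr, rfl⟩ := hi
  have hmem := List.mem_of_getElem? hr
  split_ifs with h
  · have hBint := (hE.1.1 r hmem).2.1
    have h1 := one_le_of_isInt_two_mul hB hBint h
    have hl := (hE.2 r hmem).1
    simp only [Row.sh]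
    push_cast
    refine ⟨fun _ => by linarith, fun hn _ => ?_, fun _ _ => by linarith⟩
    obtain ⟨n, hn'⟩ := isInt_iff.1 hBint
    have h2 : (2 : ℚ) ≤ n := by linarith
    have h3 : n ≠ 2 := by
      rintro rfl
      exact hn (isInt_iff.2 ⟨0, by push_cast at hn' ⊢; linarith⟩)
    have h4 : 3 ≤ n := by
      have : 2 ≤ n := by exact_mod_cast h2
      omega
    have h5 : (3 : ℚ) ≤ n := by exact_mod_cast h4
    linarith
  · have hα : alphaAt (shiftGE B E) i = alphaAt E i := by
      have : ∀ s ∈ E.take i, ¬ B ≤ s.B := by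
        intro s hs hBs
        obtain ⟨j, hj, rfl⟩ := List.mem_take_iff_getElem.1 hs
        obtain ⟨hi', rfl⟩ := List.getElem?_eq_some_iff.1 hr
        exact h (hBs.trans (List.pairwise_iff_getElem.1 hP j i (by omega) hi' (by omega)))
      rw [alphaAt, alphaAt, shiftGE, ← List.map_take]
      congr 2
      exact (List.map_congr_left fun s hs => if_neg (this s hs)).trans (List.map_id _)
    rw [hα]
    exact hE' i r hr

/-- Lemma 5.8 (first assertion): if `E` is minimal, then shifting every row with
`B_i ≥ B` (for any `B > 1/2`) one step to the left yields a non-vanishing extended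
multi-segment datum. -/
theorem minimal_shift_left (E : List Row)
    (hE : IsEMS E) (hNV : NonVanishing E) (hP : Pprime E)
    (hmin : MinimalP E) (B : ℚ) (hB : 1 / 2 < B) :
    IsEMS (shiftGE B E) ∧ NonVanishing (shiftGE B E) :=
  ⟨isEMS_shiftGE hE hP hB, starCond_shiftGE hE hNV.1 hP hB,
    fun d _ _ hF => xuAll_of_reorder_shiftGE hE hNV hP hmin B d hF⟩

end LocalArthur
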